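/- Let m ≥ 2, let 1 < q⃗_i < ∞ for i = 1,…,m, and let 1/q⃗ = 1/q⃗_1 + ⋯ + 1/q⃗_m (componentwise). Then the multi-sublinear maximal operator M_m is bounded from L^{q⃗_1}(ℝ^n)×⋯×L^{q⃗_m}(ℝ^n) to L^{q⃗}(ℝ^n): there is C > 0 such that ‖M_m(f⃗)‖_{L^{q⃗}} ≤ C Π_{i=1}^m ‖f_i‖_{L^{q⃗_i}} for all f_i ∈ L^{q⃗_i}(ℝ^n). -/

import Mathlib

open MeasureTheory ENNReal Set

noncomputable section

/-- Euclidean distance on `Fin n → ℝ`. -/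
def eudist (n : ℕ) (x y : Fin n → ℝ) : ℝ :=
  Real.sqrt (∑ i, (x i - y i) ^ 2)

/-- Open Euclidean ball in `Fin n → ℝ`. -/
def eball (n : ℕ) (x : Fin n → ℝ) (r : ℝ) : Set (Fin n → ℝ) :=
  {y | eudist n x y < r}

/-- Iterated mixed Lebesgue "norm" of an `ℝ≥0∞`-valued function: the innermost
integration is in the first coordinate with exponent `q 0`, the outermost in the
last coordinate with exponent `q (n-1)`. -/
def mixedLnorm : (n : ℕ) → (Fin n → ℝ) → ((Fin n → ℝ) → ℝ≥0∞) → ℝ≥0∞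
  | 0, _, g => g (fun i => i.elim0)
  | (n + 1), q, g =>
      (∫⁻ t : ℝ, (mixedLnorm n (fun i => q i.castSucc)
          (fun y => g (Fin.snoc y t))) ^ q (Fin.last n)) ^ (1 / q (Fin.last n))

/-- Mixed Lebesgue norm `‖f‖_{L^{q⃗}}` of a real-valued function on `ℝ^n`. -/
def mixedNorm (n : ℕ) (q : Fin n → ℝ) (f : (Fin n → ℝ) → ℝ) : ℝ≥0∞ :=
  mixedLnorm n q (fun x => ENNReal.ofReal |f x|)

/-- Generalized mixed Morrey norm of an `ℝ≥0∞`-valued function. -/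
def morreyLnorm (n : ℕ) (q : Fin n → ℝ) (φ : (Fin n → ℝ) → ℝ → ℝ)
    (g : (Fin n → ℝ) → ℝ≥0∞) : ℝ≥0∞ :=
  ⨆ (x : Fin n → ℝ) (r : ℝ) (_ : 0 < r),
    (ENNReal.ofReal (φ x r))⁻¹
      * (mixedNorm n q ((eball n x r).indicator fun _ => (1 : ℝ)))⁻¹
      * mixedLnorm n q ((eball n x r).indicator g)

/-- Generalized mixed Morrey norm `‖f‖_{M^φ_{q⃗}}` of a real-valued function. -/
def morreyNorm (n : ℕ) (q : Fin n → ℝ) (φ : (Fin n → ℝ) → ℝ → ℝ)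
    (f : (Fin n → ℝ) → ℝ) : ℝ≥0∞ :=
  morreyLnorm n q φ (fun x => ENNReal.ofReal |f x|)

/-- The BMO norm (as an extended real number). -/
def bmoNorm (n : ℕ) (b : (Fin n → ℝ) → ℝ) : ℝ≥0∞ :=
  ⨆ (x : Fin n → ℝ) (r : ℝ) (_ : 0 < r),
    ENNReal.ofReal ((volume (eball n x r)).toReal⁻¹
      * ∫ y in eball n x r, |b y - ⨍ z in eball n x r, b z|)

/-- Sublinearity in each entry of a multi-(sub)linear operator. -/
def EntrywiseSublinear (n m : ℕ)
    (T : (Fin m → ((Fin n → ℝ) → ℝ)) → ((Fin n → ℝ) → ℝ)) : Prop :=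
  (∀ (f : Fin m → ((Fin n → ℝ) → ℝ)) (i : Fin m) (g h : (Fin n → ℝ) → ℝ)
      (x : Fin n → ℝ),
      |T (Function.update f i (g + h)) x|
        ≤ |T (Function.update f i g) x| + |T (Function.update f i h) x|) ∧
  (∀ (f : Fin m → ((Fin n → ℝ) → ℝ)) (i : Fin m) (c : ℝ) (g : (Fin n → ℝ) → ℝ)
      (x : Fin n → ℝ),
      |T (Function.update f i (c • g)) x| = |c| * |T (Function.update f i g) x|)

/-- The multi-sublinear size condition (1.1) with constant `C`. -/
def SizeCond (n m : ℕ)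
    (T : (Fin m → ((Fin n → ℝ) → ℝ)) → ((Fin n → ℝ) → ℝ)) (C : ℝ) : Prop :=
  ∀ f : Fin m → ((Fin n → ℝ) → ℝ),
    (∀ i, Integrable (f i)) → (∀ i, HasCompactSupport (f i)) →
    ∀ x, x ∉ ⋂ j, Function.support (f j) →
      |T f x| ≤ C * ∫ y : Fin m → (Fin n → ℝ),
        (∏ i, |f i (y i)|) / Real.sqrt (∑ i, eudist n x (y i) ^ 2) ^ (m * n)

/-- The multi-sublinear commutator size condition (1.2), with symbol `b` and
distinguished index `i`, with constant `C`. -/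
def CommSizeCond (n m : ℕ) (b : (Fin n → ℝ) → ℝ) (i : Fin m)
    (T : (Fin m → ((Fin n → ℝ) → ℝ)) → ((Fin n → ℝ) → ℝ)) (C : ℝ) : Prop :=
  ∀ f : Fin m → ((Fin n → ℝ) → ℝ),
    (∀ k, Integrable (f k)) → (∀ k, HasCompactSupport (f k)) →
    ∀ x, x ∉ ⋂ j, Function.support (f j) →
      |T f x| ≤ C * ∫ y : Fin m → (Fin n → ℝ),
        |b x - b (y i)| * (∏ k, |f k (y k)|)
          / Real.sqrt (∑ k, eudist n x (y k) ^ 2) ^ (m * n)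

/-- The Hardy–Littlewood maximal operator. -/
def hlMax (n : ℕ) (f : (Fin n → ℝ) → ℝ) (x : Fin n → ℝ) : ℝ≥0∞ :=
  ⨆ (r : ℝ) (_ : 0 < r),
    (volume (eball n x r))⁻¹ * ∫⁻ y in eball n x r, ENNReal.ofReal |f y|

/-- The maximal commutator of the Hardy–Littlewood maximal operator. -/
def maxComm (n : ℕ) (b f : (Fin n → ℝ) → ℝ) (x : Fin n → ℝ) : ℝ≥0∞ :=
  ⨆ (r : ℝ) (_ : 0 < r),
    (volume (eball n x r))⁻¹
      * ∫⁻ y in eball n x r, ENNReal.ofReal (|b x - b y| * |f y|)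

/-- The multi-sublinear maximal operator `M_m`. -/
def multiMax (n m : ℕ) (f : Fin m → ((Fin n → ℝ) → ℝ)) (x : Fin n → ℝ) : ℝ≥0∞ :=
  ⨆ (r : ℝ) (_ : 0 < r),
    ∏ i, (volume (eball n x r))⁻¹ * ∫⁻ y in eball n x r, ENNReal.ofReal |f i y|

/-- The multi-sublinear maximal commutator `M^{b⃗}_{m,i}`. -/
def multiMaxComm (n m : ℕ) (b : Fin m → ((Fin n → ℝ) → ℝ)) (i : Fin m)
    (f : Fin m → ((Fin n → ℝ) → ℝ)) (x : Fin n → ℝ) : ℝ≥0∞ :=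
  (⨆ (r : ℝ) (_ : 0 < r),
      (volume (eball n x r))⁻¹
        * ∫⁻ y in eball n x r, ENNReal.ofReal (|b i x - b i y| * |f i y|)) *
  (⨆ (r : ℝ) (_ : 0 < r),
      ∏ k ∈ Finset.univ.erase i,
        (volume (eball n x r))⁻¹ * ∫⁻ y in eball n x r, ENNReal.ofReal |f k y|)

/-- `w` is an `A₁` weight with constant `c`. -/
def IsA1Weight (n : ℕ) (w : (Fin n → ℝ) → ℝ) (c : ℝ) : Prop :=
  (∀ x, 0 < w x) ∧ LocallyIntegrable w ∧
    ∀ (x : Fin n → ℝ) (r : ℝ), 0 < r →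
      ∀ᵐ y ∂(volume.restrict (eball n x r)),
        (volume (eball n x r)).toReal⁻¹ * ∫ z in eball n x r, w z ≤ c * w y

/-- `T` is an `m`-linear Calderón–Zygmund operator. -/
def IsCZOperator (n m : ℕ)
    (T : (Fin m → ((Fin n → ℝ) → ℝ)) → ((Fin n → ℝ) → ℝ)) : Prop :=
  -- additivity in each entry
  (∀ (f : Fin m → ((Fin n → ℝ) → ℝ)) (i : Fin m) (g h : (Fin n → ℝ) → ℝ),
      T (Function.update f i (g + h))
        = T (Function.update f i g) + T (Function.update f i h)) ∧
  -- homogeneity in each entry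
  (∀ (f : Fin m → ((Fin n → ℝ) → ℝ)) (i : Fin m) (c : ℝ) (g : (Fin n → ℝ) → ℝ),
      T (Function.update f i (c • g)) = c • T (Function.update f i g)) ∧
  -- boundedness from a product of Lebesgue spaces
  (∃ (s : Fin m → ℝ) (s₀ A : ℝ), (∀ i, 1 ≤ s i) ∧ 0 < s₀ ∧
      (1 / s₀ = ∑ i, 1 / s i) ∧ 0 < A ∧
      ∀ f : Fin m → ((Fin n → ℝ) → ℝ), (∀ i, Measurable (f i)) →
        (∀ i, mixedNorm n (fun _ => s i) (f i) ≠ ⊤) →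
        mixedNorm n (fun _ => s₀) (T f)
          ≤ ENNReal.ofReal A * ∏ i, mixedNorm n (fun _ => s i) (f i)) ∧
  -- Calderón–Zygmund kernel and representation
  (∃ (K : (Fin n → ℝ) → (Fin m → (Fin n → ℝ)) → ℝ) (ε C : ℝ), 0 < ε ∧ 0 < C ∧
      -- size estimate
      (∀ x y, ¬(∀ k, y k = x) →
        |K x y| ≤ C / (∑ k, eudist n x (y k)) ^ (m * n)) ∧
      -- regularity in the first variable
      (∀ x x' y, ¬(∀ k, y k = x) →
        2 * eudist n x x' ≤ (⨆ k, eudist n x (y k)) →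
        |K x y - K x' y|
          ≤ C * eudist n x x' ^ ε / (∑ k, eudist n x (y k)) ^ ((m * n : ℝ) + ε)) ∧
      -- regularity in each of the remaining variables
      (∀ x y (k : Fin m) (y' : Fin n → ℝ), ¬(∀ j, y j = x) →
        2 * eudist n (y k) y' ≤ (⨆ j, eudist n x (y j)) →
        |K x y - K x (Function.update y k y')|
          ≤ C * eudist n (y k) y' ^ ε / (∑ j, eudist n x (y j)) ^ ((m * n : ℝ) + ε)) ∧
      -- integral representation off the supports
      (∀ f : Fin m → ((Fin n → ℝ) → ℝ),
        (∀ j, Measurable (f j)) → (∀ j, ∃ M : ℝ, ∀ x, |f j x| ≤ M) →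
        (∀ j, HasCompactSupport (f j)) →
        ∀ x, x ∉ ⋂ j, Function.support (f j) →
          T f x = ∫ y : Fin m → (Fin n → ℝ), K x y * ∏ j, f j (y j)))

/-- The commutator `K^{b⃗}_{m,i}` of an `m`-linear operator. -/
def czComm (n m : ℕ) (T : (Fin m → ((Fin n → ℝ) → ℝ)) → ((Fin n → ℝ) → ℝ))
    (b : Fin m → ((Fin n → ℝ) → ℝ)) (i : Fin m)
    (f : Fin m → ((Fin n → ℝ) → ℝ)) : (Fin n → ℝ) → ℝ :=
  fun x => b i x * T f x - T (Function.update f i fun y => b i y * f i y) x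


/-! ### The uncentred one-dimensional maximal operator over rational intervals -/

/-- the open interval with rational endpoints -/
def rI (I : ℚ × ℚ) : Set ℝ := Ioo (I.1 : ℝ) (I.2 : ℝ)

lemma rI_meas (I : ℚ × ℚ) : MeasurableSet (rI I) := measurableSet_Ioo

/-- average with respect to a measure -/
def avI (μ : Measure ℝ) (f : ℝ → ℝ≥0∞) (I : ℚ × ℚ) : ℝ≥0∞ :=
  (μ (rI I))⁻¹ * ∫⁻ y in rI I, f y ∂μ

/-- maximal operator with respect to a measure -/
def mxl (μ : Measure ℝ) (f : ℝ → ℝ≥0∞) (x : ℝ) : ℝ≥0∞ :=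
  ⨆ I : ℚ × ℚ, (rI I).indicator (fun _ => avI μ f I) x

lemma avI_le_mxl (μ : Measure ℝ) (f : ℝ → ℝ≥0∞) (I : ℚ × ℚ) (x : ℝ) (hx : x ∈ rI I) :
    avI μ f I ≤ mxl μ f x := by
  refine le_trans ?_ (le_iSup _ I)
  simp [hx]

lemma mxl_measurable (μ : Measure ℝ) (f : ℝ → ℝ≥0∞) : Measurable (mxl μ f) := by
  unfold mxl
  exact Measurable.iSup fun I => measurable_const.indicator (rI_meas I)

lemma mxl_le (μ : Measure ℝ) (f : ℝ → ℝ≥0∞) (x : ℝ) (c : ℝ≥0∞)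
    (h : ∀ I, x ∈ rI I → avI μ f I ≤ c) : mxl μ f x ≤ c := by
  refine iSup_le fun I => ?_
  by_cases hx : x ∈ rI I
  · simpa [hx] using h I hx
  · simp [hx]

lemma exists_sub_cover (S : Finset (ℚ × ℚ)) : ∃ T ⊆ S, (⋃ I ∈ S, rI I) ⊆ (⋃ I ∈ T, rI I) ∧
    ∀ x, ∑ I ∈ T, (rI I).indicator (fun _ => (1 : ℝ≥0∞)) x ≤ 2 := by
  classical
  induction S using Finset.strongInduction with
  | H S ih =>
  by_cases h : ∀ x, (S.filter (fun I => x ∈ rI I)).card ≤ 2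
  · refine ⟨S, subset_rfl, subset_rfl, fun x => ?_⟩
    have := h x
    simp only [Set.indicator_apply, Finset.sum_boole]
    exact_mod_cast this
  · push Not at h
    obtain ⟨x, hx⟩ := h
    set F := S.filter (fun I => x ∈ rI I) with hF
    have hne : F.Nonempty := Finset.card_pos.mp (by omega)
    obtain ⟨I1, h1, h1'⟩ := F.exists_min_image (fun I => I.1) hne
    obtain ⟨I2, h2, h2'⟩ := F.exists_max_image (fun I => I.2) hne
    obtain ⟨I3, h3, h3'⟩ : ∃ I ∈ F, I ∉ ({I1, I2} : Finset (ℚ × ℚ)) := by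
      apply Finset.exists_mem_notMem_of_card_lt_card
      exact lt_of_le_of_lt (Finset.card_le_two) hx
    simp only [Finset.mem_insert, Finset.mem_singleton, not_or] at h3'
    have m1 := (Finset.mem_filter.mp h1)
    have m2 := (Finset.mem_filter.mp h2)
    have m3 := (Finset.mem_filter.mp h3)
    obtain ⟨T, hT, hU, hc⟩ := ih (S.erase I3) (Finset.erase_ssubset m3.1)
    refine ⟨T, hT.trans (Finset.erase_subset _ _), ?_, hc⟩
    refine subset_trans ?_ hU
    intro y hy
    simp only [mem_iUnion] at hy ⊢
    obtain ⟨I, hI, hyI⟩ := hy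
    by_cases hII : I = I3
    · subst hII
      have a1 : (I1.1 : ℝ) ≤ I.1 := by exact_mod_cast h1' I h3
      have a2 : (I.2 : ℝ) ≤ I2.2 := by exact_mod_cast h2' I h3
      have b1 := m1.2
      have b2 := m2.2
      simp only [rI, mem_Ioo] at b1 b2 hyI
      rcases le_total y x with hyx | hyx
      · exact ⟨I1, Finset.mem_erase.mpr ⟨fun e => h3'.1 e.symm, m1.1⟩,
          ⟨lt_of_le_of_lt a1 hyI.1, lt_of_le_of_lt hyx b1.2⟩⟩
      · exact ⟨I2, Finset.mem_erase.mpr ⟨fun e => h3'.2 e.symm, m2.1⟩,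
          ⟨lt_of_lt_of_le b2.1 hyx, lt_of_lt_of_le hyI.2 a2⟩⟩
    · exact ⟨I, Finset.mem_erase.mpr ⟨hII, hI⟩, hyI⟩

lemma lt_avI (μ : Measure ℝ) (f : ℝ → ℝ≥0∞) (I : ℚ × ℚ) (c : ℝ≥0∞) (h : c < avI μ f I) :
    c * μ (rI I) ≤ ∫⁻ y in rI I, f y ∂μ := by
  unfold avI at h
  by_cases h0 : μ (rI I) = 0
  · simp [h0]
  by_cases ht : μ (rI I) = ⊤
  · simp [ht] at h
  · rw [mul_comm, ← div_eq_mul_inv] at h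
    exact (ENNReal.le_div_iff_mul_le (Or.inl h0) (Or.inl ht)).mp h.le

lemma weak_fin (μ : Measure ℝ) {f : ℝ → ℝ≥0∞} (hf : Measurable f) (c : ℝ≥0∞)
    (S : Finset (ℚ × ℚ)) (hS : ∀ I ∈ S, c < avI μ f I) :
    c * μ (⋃ I ∈ S, rI I) ≤ 2 * ∫⁻ y, f y ∂μ := by
  obtain ⟨T, hT, hU, hc⟩ := exists_sub_cover S
  calc c * μ (⋃ I ∈ S, rI I) ≤ c * ∑ I ∈ T, μ (rI I) := by
        gcongr
        exact (measure_mono hU).trans (measure_biUnion_finset_le _ _)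
    _ = ∑ I ∈ T, c * μ (rI I) := by rw [Finset.mul_sum]
    _ ≤ ∑ I ∈ T, ∫⁻ y in rI I, f y ∂μ := Finset.sum_le_sum fun I hI => lt_avI μ f I c (hS I (hT hI))
    _ = ∑ I ∈ T, ∫⁻ y, (rI I).indicator (fun _ => (1 : ℝ≥0∞)) y * f y ∂μ := by
        refine Finset.sum_congr rfl fun I _ => ?_
        rw [← lintegral_indicator (rI_meas I)]
        refine lintegral_congr fun y => ?_
        by_cases hy : y ∈ rI I <;> simp [hy]
    _ = ∫⁻ y, ∑ I ∈ T, (rI I).indicator (fun _ => (1 : ℝ≥0∞)) y * f y ∂μ := by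
        rw [lintegral_finsetSum]
        exact fun I _ => (measurable_const.indicator (rI_meas I)).mul hf
    _ ≤ ∫⁻ y, 2 * f y ∂μ := by
        refine lintegral_mono fun y => ?_
        rw [← Finset.sum_mul]
        gcongr
        exact hc y
    _ = 2 * ∫⁻ y, f y ∂μ := lintegral_const_mul _ hf

lemma weak_type (μ : Measure ℝ) {f : ℝ → ℝ≥0∞} (hf : Measurable f) (c : ℝ≥0∞) :
    c * μ {x | c < mxl μ f x} ≤ 2 * ∫⁻ y, f y ∂μ := by
  classical
  have : {x | c < mxl μ f x} ⊆
      ⋃ S : Finset {I : ℚ × ℚ // c < avI μ f I}, ⋃ I ∈ S.image Subtype.val, rI I := by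
    intro x hx
    have hx' : c < mxl μ f x := hx
    unfold mxl at hx'
    obtain ⟨I, hI⟩ := lt_iSup_iff.mp hx'
    by_cases hxI : x ∈ rI I
    · simp only [hxI, indicator_of_mem] at hI
      refine mem_iUnion.mpr ⟨{⟨I, hI⟩}, ?_⟩
      simpa using hxI
    · simp [hxI] at hI
  refine le_trans (mul_le_mul_right (measure_mono this) c) ?_
  rw [Directed.measure_iUnion, ENNReal.mul_iSup]
  · refine iSup_le fun S => weak_fin μ hf c _ ?_
    intro I hI
    simp only [Finset.mem_image, Subtype.exists, exists_and_right, exists_eq_right] at hI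
    exact hI.1
  · refine Monotone.directed_le ?_
    intro S T hST
    exact biUnion_subset_biUnion_left (Finset.image_subset_image hST)

/-- Layer cake identity at a point. -/
lemma layer_pt (a : ℝ≥0∞) {p : ℝ} (hp : 0 < p) :
    a ^ p = ENNReal.ofReal p * ∫⁻ t in Ioi (0 : ℝ),
      {t : ℝ | ENNReal.ofReal t < a}.indicator (fun _ => (1 : ℝ≥0∞)) t * ENNReal.ofReal (t ^ (p - 1)) := by
  have key : ∀ b : ℝ, 0 ≤ b → (ENNReal.ofReal b) ^ p = ENNReal.ofReal p * ∫⁻ t in Ioi (0 : ℝ),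
      {t : ℝ | ENNReal.ofReal t < ENNReal.ofReal b}.indicator (fun _ => (1 : ℝ≥0∞)) t
        * ENNReal.ofReal (t ^ (p - 1)) := by
    intro b hb
    have := lintegral_rpow_eq_lintegral_meas_lt_mul (Measure.dirac (0 : ℝ)) (f := fun _ => b)
      (by filter_upwards with x using hb) aemeasurable_const hp
    simp only [lintegral_const, measure_univ, mul_one] at this
    rw [ENNReal.ofReal_rpow_of_nonneg hb hp.le, this]
    congr 1
    refine setLIntegral_congr_fun measurableSet_Ioi fun t ht => ?_
    simp only [mem_Ioi] at ht
    by_cases h : t < b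
    · simp [h, ENNReal.ofReal_lt_ofReal_iff (ht.trans h)]
    · have : ¬ (ENNReal.ofReal t < ENNReal.ofReal b) := by
        rw [not_lt] at h ⊢
        exact ENNReal.ofReal_le_ofReal h
      simp [h, this]
  by_cases ha : a = ⊤
  · subst ha
    rw [ENNReal.top_rpow_of_pos hp]
    symm
    refine ENNReal.eq_top_of_forall_nnreal_le fun r => ?_
    have h1 := key ((r : ℝ) ^ (1 / p)) (by positivity)
    have h2 : (ENNReal.ofReal ((r : ℝ) ^ (1 / p))) ^ p = r := by
      rw [ENNReal.ofReal_rpow_of_nonneg (by positivity) hp.le, ← Real.rpow_mul (by positivity)]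
      rw [one_div_mul_cancel hp.ne', Real.rpow_one]
      simp
    rw [h2] at h1
    rw [h1]
    gcongr
    exact le_top
  · have := key a.toReal ENNReal.toReal_nonneg
    rwa [ENNReal.ofReal_toReal ha] at this

lemma layer_meas {g : ℝ → ℝ≥0∞} (hg : Measurable g) (r : ℝ) :
    Measurable (Function.uncurry fun (x t : ℝ) =>
      {t : ℝ | ENNReal.ofReal t < g x}.indicator (fun _ => (1 : ℝ≥0∞)) t * ENNReal.ofReal (t ^ r)) := by
  have h1 : MeasurableSet {z : ℝ × ℝ | ENNReal.ofReal z.2 < g z.1} :=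
    measurableSet_lt (by fun_prop) (by fun_prop)
  have h2 : Measurable (({z : ℝ × ℝ | ENNReal.ofReal z.2 < g z.1}).indicator
      (fun _ => (1 : ℝ≥0∞))) := measurable_const.indicator h1
  have h3 : Measurable fun z : ℝ × ℝ => ENNReal.ofReal (z.2 ^ r) := by fun_prop
  exact h2.mul h3

lemma mxl_split (μ : Measure ℝ) {f : ℝ → ℝ≥0∞} (hf : Measurable f) (c : ℝ≥0∞) (x : ℝ) :
    mxl μ f x ≤ mxl μ ({x | c < f x}.indicator f) x + c := by
  refine mxl_le _ _ _ _ fun I hI => ?_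
  refine le_trans ?_ (add_le_add_left (avI_le_mxl _ _ I x hI) c)
  unfold avI
  calc (μ (rI I))⁻¹ * ∫⁻ y in rI I, f y ∂μ
      ≤ (μ (rI I))⁻¹ * ∫⁻ y in rI I, ({x | c < f x}.indicator f y + c) ∂μ := by
        gcongr with y
        by_cases h : c < f y
        · simp [h]
        · simp only [mem_ofPred_eq, h, not_false_eq_true, indicator_of_notMem, zero_add]
          exact not_lt.mp h
    _ = (μ (rI I))⁻¹ * ∫⁻ y in rI I, {x | c < f x}.indicator f y ∂μ + (μ (rI I))⁻¹ * μ (rI I) * c := by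
        rw [lintegral_add_right _ measurable_const, mul_add]
        simp only [lintegral_const, Measure.restrict_apply, MeasurableSet.univ, univ_inter]
        ring
    _ ≤ _ := by
        gcongr
        calc (μ (rI I))⁻¹ * μ (rI I) * c ≤ 1 * c := by
              gcongr; exact ENNReal.inv_mul_le_one _
          _ = c := one_mul c

lemma strong_type {p : ℝ} (hp : 1 < p) : ∃ C : ℝ≥0∞, C ≠ ⊤ ∧ ∀ (μ : Measure ℝ) [SFinite μ]
    (f : ℝ → ℝ≥0∞), Measurable f → ∫⁻ x, (mxl μ f x) ^ p ∂μ ≤ C * ∫⁻ x, (f x) ^ p ∂μ := by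
  refine ⟨ENNReal.ofReal p * (4 * ((ENNReal.ofReal (p - 1))⁻¹ * 2 ^ (p - 1))), ?_, ?_⟩
  · refine ENNReal.mul_ne_top ofReal_ne_top (ENNReal.mul_ne_top (by norm_num)
      (ENNReal.mul_ne_top ?_ ?_))
    · simpa using hp
    · exact ENNReal.rpow_ne_top_of_nonneg (by linarith) (by norm_num)
  intro μ _ f hf
  have hp0 : 0 < p := by linarith
  have hp1 : 0 < p - 1 := by linarith
  have hM := mxl_measurable μ f
  calc ∫⁻ x, (mxl μ f x) ^ p ∂μ
      = ∫⁻ x, ENNReal.ofReal p * (∫⁻ t in Ioi (0 : ℝ),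
      {t : ℝ | ENNReal.ofReal t < mxl μ f x}.indicator (fun _ => (1 : ℝ≥0∞)) t
        * ENNReal.ofReal (t ^ (p - 1))) ∂μ := lintegral_congr fun x => layer_pt _ hp0
    _ = ENNReal.ofReal p * ∫⁻ x, (∫⁻ t in Ioi (0 : ℝ),
      {t : ℝ | ENNReal.ofReal t < mxl μ f x}.indicator (fun _ => (1 : ℝ≥0∞)) t
        * ENNReal.ofReal (t ^ (p - 1))) ∂μ := by
        rw [lintegral_const_mul' _ _ ofReal_ne_top]
    _ = ENNReal.ofReal p * ∫⁻ t in Ioi (0 : ℝ), ∫⁻ x, 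
      {t : ℝ | ENNReal.ofReal t < mxl μ f x}.indicator (fun _ => (1 : ℝ≥0∞)) t
        * ENNReal.ofReal (t ^ (p - 1)) ∂μ := by
        rw [lintegral_lintegral_swap]
        exact (layer_meas hM _).aemeasurable
    _ ≤ ENNReal.ofReal p * ∫⁻ t in Ioi (0 : ℝ), 4 * ∫⁻ x, 
      f x * ({t : ℝ | ENNReal.ofReal t < 2 * f x}.indicator (fun _ => (1 : ℝ≥0∞)) t
        * ENNReal.ofReal (t ^ (p - 1 - 1))) ∂μ := by
        refine mul_le_mul_right (setLIntegral_mono' measurableSet_Ioi fun t ht => ?_) _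
        simp only [mem_Ioi] at ht
        rw [lintegral_mul_const' _ _ ofReal_ne_top]
        have e1 : ∫⁻ x, {t : ℝ | ENNReal.ofReal t < mxl μ f x}.indicator (fun _ => (1 : ℝ≥0∞)) t ∂μ
            = μ {x | ENNReal.ofReal t < mxl μ f x} := by
          rw [← lintegral_indicator_one (measurableSet_lt measurable_const hM)]
          rfl
        rw [e1]
        set c := ENNReal.ofReal (t / 2) with hc
        have hcc : ENNReal.ofReal t = c + c := by
          rw [hc, ← ENNReal.ofReal_add (by positivity) (by positivity)]; simp
        have e2 : μ {x | ENNReal.ofReal t < mxl μ f x} ≤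
            μ {x | c < mxl μ ({x | c < f x}.indicator f) x} := by
          refine measure_mono fun x hx => ?_
          have := lt_of_lt_of_le hx (mxl_split μ hf c x)
          rw [hcc] at this
          exact lt_of_add_lt_add_right this
        have hms : MeasurableSet {x | c < f x} := measurableSet_lt measurable_const hf
        have e3 := weak_type μ (hf.indicator hms) c
        have e4 : ENNReal.ofReal (t ^ (p - 1)) = 2 * c * ENNReal.ofReal (t ^ (p - 1 - 1)) := by
          rw [two_mul, ← hcc, ← ENNReal.ofReal_mul ht.le]
          congr 1
          rw [mul_comm, ← Real.rpow_add_one ht.ne']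
          congr 1; ring
        rw [e4]
        calc _ = 2 * (c * μ {x | ENNReal.ofReal t < mxl μ f x}) * ENNReal.ofReal (t ^ (p - 1 - 1)) := by ring
          _ ≤ 2 * (2 * ∫⁻ y, {x | c < f x}.indicator f y ∂μ) * ENNReal.ofReal (t ^ (p - 1 - 1)) := by
            refine mul_le_mul_left (mul_le_mul_right ?_ _) _
            exact le_trans (mul_le_mul_right e2 _) e3
          _ = 4 * ((∫⁻ y, {x | c < f x}.indicator f y ∂μ) * ENNReal.ofReal (t ^ (p - 1 - 1))) := by ring
          _ = _ := by
            rw [← lintegral_mul_const' _ _ ofReal_ne_top]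
            congr 1
            refine lintegral_congr fun x => ?_
            have : ENNReal.ofReal t < 2 * f x ↔ c < f x := by
              rw [hcc, ← two_mul]
              exact ENNReal.mul_lt_mul_iff_right (by norm_num) (by norm_num)
            by_cases h : c < f x
            · simp [h, this]
            · simp only [mem_ofPred_eq, this, h, not_false_eq_true, indicator_of_notMem, zero_mul, mul_zero]
    _ = ENNReal.ofReal p * (4 * ∫⁻ x, (∫⁻ t in Ioi (0 : ℝ),
      f x * ({t : ℝ | ENNReal.ofReal t < 2 * f x}.indicator (fun _ => (1 : ℝ≥0∞)) t
        * ENNReal.ofReal (t ^ (p - 1 - 1)))) ∂μ) := by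
        rw [lintegral_const_mul' _ _ (by norm_num)]
        congr 2
        symm
        apply lintegral_lintegral_swap
        have := (layer_meas (hf.const_mul 2) (p - 1 - 1))
        exact ((hf.comp measurable_fst).mul this).aemeasurable
    _ = ENNReal.ofReal p * (4 * ∫⁻ x, ((ENNReal.ofReal (p - 1))⁻¹ * 2 ^ (p - 1)) * f x ^ p ∂μ) := by
        congr 2
        refine lintegral_congr fun x => ?_
        have h1 := layer_pt (2 * f x) hp1
        have hm : Measurable fun t : ℝ => {t : ℝ | ENNReal.ofReal t < 2 * f x}.indicator
            (fun _ => (1 : ℝ≥0∞)) t * ENNReal.ofReal (t ^ (p - 1 - 1)) :=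
          (measurable_const.indicator (measurableSet_lt (by fun_prop) measurable_const)).mul
            (by fun_prop)
        rw [lintegral_const_mul _ hm]
        have hne : ENNReal.ofReal (p - 1) ≠ 0 := by simpa using hp
        have h2 : ∫⁻ t in Ioi (0 : ℝ), {t : ℝ | ENNReal.ofReal t < 2 * f x}.indicator
            (fun _ => (1 : ℝ≥0∞)) t * ENNReal.ofReal (t ^ (p - 1 - 1))
            = (ENNReal.ofReal (p - 1))⁻¹ * (2 * f x) ^ (p - 1) := by
          rw [h1, ← mul_assoc, ENNReal.inv_mul_cancel hne ofReal_ne_top, one_mul]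
        rw [h2, ENNReal.mul_rpow_of_nonneg _ _ hp1.le]
        have h3 : f x ^ p = f x * f x ^ (p - 1) := by
          conv_rhs => rw [← ENNReal.rpow_one (f x), ← ENNReal.rpow_mul, one_mul,
            ← ENNReal.rpow_add_of_nonneg _ _ zero_le_one hp1.le]
          congr 1; ring
        rw [h3]; ring
    _ = _ := by
        rw [lintegral_const_mul _ (hf.pow_const p)]
        ring

/-! ### `A₁` weights and the Muckenhoupt theorem for factored weights -/

/-- `A₁` weight with constant `K` in one dimension. -/
structure A1w (K : ℝ≥0∞) (u : ℝ → ℝ≥0∞) : Prop where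
  meas : Measurable u
  pos : ∀ x, u x ≠ 0
  fin : ∀ᵐ x, u x ≠ ⊤
  le : ∀ x, mxl volume u x ≤ K * u x

/-- factored weight -/
def wt (p : ℝ) (u v : ℝ → ℝ≥0∞) (x : ℝ) : ℝ≥0∞ := u x * (v x) ^ (1 - p)

lemma wt_meas {p : ℝ} {u v : ℝ → ℝ≥0∞} (hu : Measurable u) (hv : Measurable v) :
    Measurable (wt p u v) := hu.mul (hv.pow_const _)

lemma hc_mul {p q : ℝ} (h : p.HolderConjugate q) : (1 - p) * (1 - q) = 1 := by
  have := h.mul_eq_add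
  nlinarith

lemma wt_dual {p q : ℝ} (h : p.HolderConjugate q) {u v : ℝ≥0∞} (hu : u ≠ 0) (hu' : u ≠ ⊤)
    (hv : v ≠ 0) (hv' : v ≠ ⊤) :
    ((u * v ^ (1 - p))⁻¹) ^ q * (u * v ^ (1 - p)) = v * u ^ (1 - q) := by
  have h1 : v ^ (1 - p) ≠ ⊤ := ENNReal.rpow_ne_top_of_ne_zero hv hv'
  have h0 : v ^ (1 - p) ≠ 0 := by simp [ENNReal.rpow_eq_zero_iff, hv, hv']
  have w1 : u * v ^ (1 - p) ≠ ⊤ := ENNReal.mul_ne_top hu' h1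
  have w0 : u * v ^ (1 - p) ≠ 0 := mul_ne_zero hu h0
  rw [ENNReal.inv_rpow, ← ENNReal.rpow_neg]
  nth_rewrite 2 [← ENNReal.rpow_one (u * v ^ (1 - p))]
  rw [← ENNReal.rpow_add _ _ w0 w1, ENNReal.mul_rpow_of_ne_top hu' h1, ← ENNReal.rpow_mul]
  rw [show (1 - p) * (-q + 1) = 1 by linarith [hc_mul h], ENNReal.rpow_one, mul_comm,
    show -q + 1 = 1 - q by ring]

lemma wt_ne {p : ℝ} {u v : ℝ≥0∞} (hu : u ≠ 0) (hu' : u ≠ ⊤)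
    (hv : v ≠ 0) (hv' : v ≠ ⊤) : u * v ^ (1 - p) ≠ 0 ∧ u * v ^ (1 - p) ≠ ⊤ := by
  have h1 : v ^ (1 - p) ≠ ⊤ := ENNReal.rpow_ne_top_of_ne_zero hv hv'
  have h0 : v ^ (1 - p) ≠ 0 := by simp [ENNReal.rpow_eq_zero_iff, hv, hv']
  exact ⟨mul_ne_zero hu h0, ENNReal.mul_ne_top hu' h1⟩

lemma wt_ae {p K} {u v : ℝ → ℝ≥0∞} (hu : A1w K u) (hv : A1w K v) :
    ∀ᵐ x, wt p u v x ≠ 0 ∧ wt p u v x ≠ ⊤ := by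
  filter_upwards [hu.fin, hv.fin] with x h1 h2
  exact wt_ne (hu.pos x) h1 (hv.pos x) h2

lemma real_ap {p q : ℝ} (h : p.HolderConjugate q) {a b K L : ℝ} (ha : 0 < a) (hb : 0 < b)
    (hK : 0 < K) (hL : 0 < L) :
    (b / K) ^ (1 - p) * L * a * ((a / K) ^ (1 - q) * L * b) ^ (p - 1) = K ^ p * L ^ p := by
  rw [Real.mul_rpow (by positivity) hb.le, Real.mul_rpow (by positivity) hL.le,
    ← Real.rpow_mul (by positivity), show (1 - q) * (p - 1) = -1 by linarith [hc_mul h],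
    show 1 - p = -(p - 1) by ring, Real.rpow_neg (by positivity), Real.rpow_neg_one,
    Real.div_rpow hb.le hK.le]
  have e1 : K ^ p = K ^ (p - 1) * K := by
    rw [← Real.rpow_add_one hK.ne']; congr 1; ring
  have e2 : L ^ p = L ^ (p - 1) * L := by
    rw [← Real.rpow_add_one hL.ne']; congr 1; ring
  rw [e1, e2]
  have : 0 < b ^ (p - 1) := by positivity
  field_simp

lemma ennreal_ap {p q : ℝ} (h : p.HolderConjugate q) {a b K L : ℝ≥0∞} (ha : a ≠ 0) (hb : b ≠ 0)
    (hK : K ≠ 0) (hL : L ≠ 0) (ha' : a ≠ ⊤) (hb' : b ≠ ⊤) (hK' : K ≠ ⊤) (hL' : L ≠ ⊤) :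
    (b / K) ^ (1 - p) * L * a * ((a / K) ^ (1 - q) * L * b) ^ (p - 1) = K ^ p * L ^ p := by
  have key : ∀ x : ℝ≥0∞, x ≠ 0 → x ≠ ⊤ → ∃ r : ℝ, 0 < r ∧ x = ENNReal.ofReal r := fun x h0 ht =>
    ⟨x.toReal, ENNReal.toReal_pos h0 ht, (ENNReal.ofReal_toReal ht).symm⟩
  obtain ⟨a, pa, rfl⟩ := key a ha ha'
  obtain ⟨b, pb, rfl⟩ := key b hb hb'
  obtain ⟨K, pK, rfl⟩ := key K hK hK'
  obtain ⟨L, pL, rfl⟩ := key L hL hL'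
  have hp := h.sub_one_pos
  rw [← ENNReal.ofReal_div_of_pos pK, ← ENNReal.ofReal_div_of_pos pK,
    ENNReal.ofReal_rpow_of_pos (by positivity), ENNReal.ofReal_rpow_of_pos (by positivity),
    ENNReal.ofReal_rpow_of_pos pK, ENNReal.ofReal_rpow_of_pos pL, 
    ← ENNReal.ofReal_mul (by positivity), ← ENNReal.ofReal_mul (by positivity),
    ← ENNReal.ofReal_mul (by positivity), ← ENNReal.ofReal_mul (by positivity),
    ENNReal.ofReal_rpow_of_pos (by positivity),
    ← ENNReal.ofReal_mul (by positivity), ← ENNReal.ofReal_mul (by positivity),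
    real_ap h pa pb pK pL]

lemma vol_rI {I : ℚ × ℚ} {x : ℝ} (hx : x ∈ rI I) :
    volume (rI I) ≠ 0 ∧ volume (rI I) ≠ ⊤ := by
  have : (I.1 : ℝ) < I.2 := hx.1.trans hx.2
  constructor
  · simp [rI, Real.volume_Ioo]; exact_mod_cast this
  · simp [rI, Real.volume_Ioo]

lemma A1w.av {K : ℝ≥0∞} {u : ℝ → ℝ≥0∞} (hK : K ≠ ⊤) (hu : A1w K u) {I : ℚ × ℚ} {x : ℝ}
    (hx : x ∈ rI I) : avI volume u I ≠ 0 ∧ avI volume u I ≠ ⊤ := by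
  obtain ⟨v0, vt⟩ := vol_rI hx
  constructor
  · unfold avI
    refine mul_ne_zero (ENNReal.inv_ne_zero.mpr vt) ?_
    intro h0
    rw [lintegral_eq_zero_iff hu.meas] at h0
    have : ∀ᵐ y ∂(volume.restrict (rI I)), False := by
      filter_upwards [h0] with y hy using hu.pos y hy
    rw [Filter.eventually_false_iff_eq_bot, ae_eq_bot, Measure.restrict_eq_zero] at this
    exact v0 this
  · have : ∃ y ∈ rI I, u y ≠ ⊤ := by
      by_contra hcon
      push Not at hcon
      apply v0
      refine measure_mono_null ?_ (ae_iff.mp hu.fin)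
      intro y hy
      simpa using hcon y hy
    obtain ⟨y, hy, hyt⟩ := this
    exact ne_top_of_le_ne_top (ENNReal.mul_ne_top hK hyt)
      ((avI_le_mxl volume u I y hy).trans (hu.le y))

lemma int_eq_av (μ : Measure ℝ) (f : ℝ → ℝ≥0∞) (I : ℚ × ℚ) (h0 : μ (rI I) ≠ 0)
    (ht : μ (rI I) ≠ ⊤) : ∫⁻ y in rI I, f y ∂μ = μ (rI I) * avI μ f I := by
  unfold avI
  rw [← mul_assoc, ENNReal.mul_inv_cancel h0 ht, one_mul]

lemma int_wt_le {p K} (hp : 1 < p) (hK : K ≠ ⊤) (hK0 : K ≠ 0) {u v : ℝ → ℝ≥0∞} (hu : A1w K u)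
    (hv : A1w K v) {I : ℚ × ℚ} {x : ℝ} (hx : x ∈ rI I) :
    ∫⁻ y in rI I, wt p u v y ≤
      (avI volume v I / K) ^ (1 - p) * volume (rI I) * avI volume u I := by
  obtain ⟨v0, vt⟩ := vol_rI hx
  obtain ⟨b0, bt⟩ := hv.av hK hx
  calc ∫⁻ y in rI I, wt p u v y ≤ ∫⁻ y in rI I, (avI volume v I / K) ^ (1 - p) * u y := by
        refine setLIntegral_mono' (rI_meas I) fun y hy => ?_
        unfold wt
        rw [mul_comm]
        refine mul_le_mul_left ?_ _
        rw [show 1 - p = -(p - 1) by ring, ENNReal.rpow_neg, ENNReal.rpow_neg]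
        apply ENNReal.inv_le_inv.mpr
        refine ENNReal.rpow_le_rpow ?_ (by linarith)
        refine ENNReal.div_le_of_le_mul' ?_
        exact (avI_le_mxl _ _ I y hy).trans (hv.le y)
    _ = _ := by
        rw [lintegral_const_mul _ hu.meas, int_eq_av volume u I v0 vt]
        ring

lemma int_wt_ne {p K} (hp : 1 < p) (hK : K ≠ ⊤) (hK0 : K ≠ 0) {u v : ℝ → ℝ≥0∞} (hu : A1w K u)
    (hv : A1w K v) {I : ℚ × ℚ} {x : ℝ} (hx : x ∈ rI I) :
    ∫⁻ y in rI I, wt p u v y ≠ 0 ∧ ∫⁻ y in rI I, wt p u v y ≠ ⊤ := by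
  obtain ⟨v0, vt⟩ := vol_rI hx
  constructor
  · intro h0
    rw [lintegral_eq_zero_iff (wt_meas hu.meas hv.meas)] at h0
    have : ∀ᵐ y ∂(volume.restrict (rI I)), False := by
      filter_upwards [h0, ae_restrict_of_ae (wt_ae (p := p) hu hv)] with y hy hy' using hy'.1 hy
    rw [Filter.eventually_false_iff_eq_bot, ae_eq_bot, Measure.restrict_eq_zero] at this
    exact v0 this
  · refine ne_top_of_le_ne_top ?_ (int_wt_le hp hK hK0 hu hv hx)
    refine ENNReal.mul_ne_top (ENNReal.mul_ne_top ?_ vt) (hu.av hK hx).2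
    have hb := hv.av hK hx
    exact ENNReal.rpow_ne_top_of_ne_zero (ENNReal.div_ne_zero.mpr ⟨hb.1, hK⟩)
      (ENNReal.div_ne_top hb.2 hK0)

lemma ap_bound {p q : ℝ} (h : p.HolderConjugate q) {K} (hK : K ≠ ⊤) (hK0 : K ≠ 0)
    {u v : ℝ → ℝ≥0∞} (hu : A1w K u)
    (hv : A1w K v) {I : ℚ × ℚ} {x : ℝ} (hx : x ∈ rI I) :
    (∫⁻ y in rI I, wt p u v y) * (∫⁻ y in rI I, wt q v u y) ^ (p - 1)
      ≤ K ^ p * volume (rI I) ^ p := by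
  obtain ⟨v0, vt⟩ := vol_rI hx
  obtain ⟨a0, aT⟩ := hu.av hK hx
  obtain ⟨b0, bT⟩ := hv.av hK hx
  rw [← ennreal_ap h a0 b0 hK0 v0 aT bT hK vt]
  gcongr
  · exact int_wt_le h.lt hK hK0 hu hv hx
  · exact h.sub_one_pos.le
  · exact int_wt_le h.symm.lt hK hK0 hv hu hx

lemma lerner_pt {p q : ℝ} (h : p.HolderConjugate q) {K} (hK : K ≠ ⊤) (hK0 : K ≠ 0)
    {u v : ℝ → ℝ≥0∞} (hu : A1w K u) (hv : A1w K v) {f : ℝ → ℝ≥0∞} (hf : Measurable f) (x : ℝ) :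
    mxl volume f x ^ (p - 1) ≤ K ^ p * mxl (volume.withDensity (wt p u v))
      (fun y => mxl (volume.withDensity (wt q v u)) (fun z => f z * (wt q v u z)⁻¹) y ^ (p - 1)
        * (wt p u v y)⁻¹) x := by
  set w := wt p u v with hw
  set s := wt q v u with hs
  have hwm : Measurable w := wt_meas hu.meas hv.meas
  have hsm : Measurable s := wt_meas hv.meas hu.meas
  set φ := mxl (volume.withDensity s) (fun z => f z * (s z)⁻¹) with hφ
  have hφm : Measurable φ := mxl_measurable _ _
  have hp1 := h.sub_one_pos
  -- reduce to intervals
  have red : mxl volume f x ≤ (K ^ p * mxl (volume.withDensity w)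
      (fun y => φ y ^ (p - 1) * (w y)⁻¹) x) ^ (p - 1)⁻¹ := by
    refine mxl_le _ _ _ _ fun I hI => ?_
    rw [ENNReal.le_rpow_inv_iff hp1]
    refine le_trans ?_ (mul_le_mul_right (avI_le_mxl _ _ I x hI) _)
    obtain ⟨v0, vt⟩ := vol_rI hI
    have hwI : (volume.withDensity w) (rI I) = ∫⁻ y in rI I, w y := withDensity_apply _ (rI_meas I)
    have hsI : (volume.withDensity s) (rI I) = ∫⁻ y in rI I, s y := withDensity_apply _ (rI_meas I)
    obtain ⟨w0, wT⟩ := int_wt_ne h.lt hK hK0 hu hv hI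
    obtain ⟨s0, sT⟩ := int_wt_ne h.symm.lt hK hK0 hv hu hI
    rw [← hw] at w0 wT
    rw [← hs] at s0 sT
    have hap := ap_bound h hK hK0 hu hv hI
    rw [← hw, ← hs] at hap
    set W := ∫⁻ y in rI I, w y with hW
    set Sg := ∫⁻ y in rI I, s y with hSg
    set Lg := volume (rI I) with hLg
    -- average of f
    have f1 : ∫⁻ y in rI I, f y = Sg * avI (volume.withDensity s) (fun z => f z * (s z)⁻¹) I := by
      rw [← hsI, ← int_eq_av _ _ _ (hsI ▸ s0) (hsI ▸ sT)]
      rw [setLIntegral_withDensity_eq_setLIntegral_mul _ hsm (g := fun y => f y * (s y)⁻¹) (hf.mul hsm.inv) (rI_meas I)]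
      refine lintegral_congr_ae (ae_restrict_of_ae ?_)
      filter_upwards [wt_ae (p := q) hv hu] with y hy
      simp only [Pi.mul_apply]
      rw [mul_comm (f y), ← mul_assoc, ENNReal.mul_inv_cancel hy.1 hy.2, one_mul]
    have f2 : Lg * (avI volume f I) ^ (p - 1) ≤ (Lg⁻¹ * Sg) ^ (p - 1) * ∫⁻ y in rI I, φ y ^ (p - 1) := by
      rw [← lintegral_const_mul _ (hφm.pow_const _)]
      calc Lg * (avI volume f I) ^ (p - 1) = ∫⁻ y in rI I, (avI volume f I) ^ (p - 1) := by
            simp [mul_comm, hLg]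
        _ ≤ _ := by
            refine setLIntegral_mono' (rI_meas I) fun y hy => ?_
            rw [← ENNReal.mul_rpow_of_nonneg _ _ hp1.le]
            refine ENNReal.rpow_le_rpow ?_ hp1.le
            unfold avI
            rw [f1, mul_assoc]
            gcongr
            exact avI_le_mxl _ _ I y hy
    have f3 : avI (volume.withDensity w) (fun y => φ y ^ (p - 1) * (w y)⁻¹) I
        = W⁻¹ * ∫⁻ y in rI I, φ y ^ (p - 1) := by
      unfold avI
      rw [hwI]
      congr 1
      rw [setLIntegral_withDensity_eq_setLIntegral_mul _ hwm
        (g := fun y => φ y ^ (p - 1) * (w y)⁻¹) ((hφm.pow_const _).mul hwm.inv)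
        (rI_meas I)]
      refine lintegral_congr_ae (ae_restrict_of_ae ?_)
      filter_upwards [wt_ae (p := p) hu hv] with y hy
      simp only [Pi.mul_apply]
      rw [mul_comm (φ y ^ (p - 1)), ← mul_assoc, ENNReal.mul_inv_cancel hy.1 hy.2, one_mul]
    rw [f3]
    have f4 : (Lg⁻¹ * Sg) ^ (p - 1) ≤ K ^ p * Lg * W⁻¹ := by
      rw [← div_eq_mul_inv, ENNReal.le_div_iff_mul_le (Or.inl w0) (Or.inl wT),
        ENNReal.mul_rpow_of_nonneg _ _ hp1.le]
      calc (Lg⁻¹) ^ (p - 1) * Sg ^ (p - 1) * W = (Lg⁻¹) ^ (p - 1) * (W * Sg ^ (p - 1)) := by ring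
        _ ≤ (Lg⁻¹) ^ (p - 1) * (K ^ p * Lg ^ p) := by gcongr
        _ = K ^ p * Lg := by
            rw [ENNReal.inv_rpow, ← ENNReal.rpow_neg, mul_left_comm,
              ← ENNReal.rpow_add _ _ v0 vt]
            simp
    have f5 := f2.trans (mul_le_mul_left f4 _)
    rw [show K ^ p * Lg * W⁻¹ * ∫⁻ y in rI I, φ y ^ (p - 1)
      = Lg * (K ^ p * (W⁻¹ * ∫⁻ y in rI I, φ y ^ (p - 1))) by ring] at f5
    exact (ENNReal.mul_le_mul_iff_right v0 vt).mp f5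
  exact (ENNReal.le_rpow_inv_iff hp1).mp red

lemma muck {p : ℝ} (hp : 1 < p) {K : ℝ≥0∞} (hK : K ≠ ⊤) (hK0 : K ≠ 0) :
    ∃ A : ℝ≥0∞, A ≠ ⊤ ∧ 1 ≤ A ∧ ∀ u v, A1w K u → A1w K v → ∀ f : ℝ → ℝ≥0∞, Measurable f →
      ∫⁻ x, mxl volume f x ^ p * wt p u v x ≤ A * ∫⁻ x, f x ^ p * wt p u v x := by
  have h : p.HolderConjugate (Real.conjExponent p) := Real.HolderConjugate.conjExponent hp
  set q := Real.conjExponent p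
  have hp1 := h.sub_one_pos
  have hq0 : 0 < q := h.symm.pos
  obtain ⟨Cp, hCp, hCp'⟩ := strong_type hp
  obtain ⟨Cq, hCq, hCq'⟩ := strong_type h.symm.lt
  refine ⟨max 1 ((K ^ p) ^ q * (Cq * Cp)), ?_, le_max_left _ _, ?_⟩
  · refine (max_lt (by norm_num) ?_).ne
    refine (ENNReal.mul_ne_top ?_ (ENNReal.mul_ne_top hCq hCp)).lt_top
    exact ENNReal.rpow_ne_top_of_nonneg hq0.le
      (ENNReal.rpow_ne_top_of_nonneg (by linarith) hK)
  intro u v hu hv f hf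
  refine le_trans ?_ (mul_le_mul_left (le_max_right _ _) _)
  have hL := lerner_pt h hK hK0 hu hv hf
  have hwm : Measurable (wt p u v) := wt_meas hu.meas hv.meas
  have hsm : Measurable (wt q v u) := wt_meas hv.meas hu.meas
  set φ := mxl (volume.withDensity (wt q v u)) (fun z => f z * (wt q v u z)⁻¹) with hφ
  have hφm : Measurable φ := mxl_measurable _ _
  set g : ℝ → ℝ≥0∞ := fun y => φ y ^ (p - 1) * (wt p u v y)⁻¹ with hg
  have hgm : Measurable g := (hφm.pow_const _).mul hwm.inv
  have hpq : (p - 1) * q = p := by have := h.mul_eq_add; linarith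
  calc ∫⁻ x, mxl volume f x ^ p * wt p u v x
      ≤ ∫⁻ x, (K ^ p) ^ q * (wt p u v x * mxl (volume.withDensity (wt p u v)) g x ^ q) := by
        refine lintegral_mono fun x => ?_
        have : mxl volume f x ^ p = (mxl volume f x ^ (p - 1)) ^ q := by
          rw [← ENNReal.rpow_mul, hpq]
        simp only [this]
        calc (mxl volume f x ^ (p - 1)) ^ q * wt p u v x
            ≤ (K ^ p * mxl (volume.withDensity (wt p u v)) g x) ^ q * wt p u v x := by
              gcongr
              exact hL x
          _ = _ := by rw [ENNReal.mul_rpow_of_nonneg _ _ hq0.le]; ring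
    _ = (K ^ p) ^ q * ∫⁻ x, mxl (volume.withDensity (wt p u v)) g x ^ q
          ∂(volume.withDensity (wt p u v)) := by
        rw [lintegral_withDensity_eq_lintegral_mul _ hwm ((mxl_measurable _ _).pow_const _),
          lintegral_const_mul]
        · rfl
        · exact hwm.mul ((mxl_measurable _ _).pow_const _)
    _ ≤ (K ^ p) ^ q * (Cq * ∫⁻ x, g x ^ q ∂(volume.withDensity (wt p u v))) := by
        gcongr
        exact hCq' _ _ hgm
    _ = (K ^ p) ^ q * (Cq * ∫⁻ x, φ x ^ p ∂(volume.withDensity (wt q v u))) := by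
        congr 2
        rw [lintegral_withDensity_eq_lintegral_mul _ hwm (hgm.pow_const _),
          lintegral_withDensity_eq_lintegral_mul _ hsm (hφm.pow_const _)]
        refine lintegral_congr_ae ?_
        filter_upwards [hu.fin, hv.fin] with x hux hvx
        have := wt_dual h (hu.pos x) hux (hv.pos x) hvx
        simp only [Pi.mul_apply, hg]
        rw [ENNReal.mul_rpow_of_nonneg _ _ hq0.le, ← ENNReal.rpow_mul, hpq]
        unfold wt
        rw [← this]; ring
    _ ≤ (K ^ p) ^ q * (Cq * (Cp * ∫⁻ x, (f x * (wt q v u x)⁻¹) ^ p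
          ∂(volume.withDensity (wt q v u)))) := by
        gcongr
        exact hCp' _ _ (hf.mul hsm.inv)
    _ = (K ^ p) ^ q * (Cq * (Cp * ∫⁻ x, f x ^ p * wt p u v x)) := by
        congr 3
        rw [lintegral_withDensity_eq_lintegral_mul _ hsm
          (g := fun x => (f x * (wt q v u x)⁻¹) ^ p) ((hf.mul hsm.inv).pow_const _)]
        refine lintegral_congr_ae ?_
        filter_upwards [hu.fin, hv.fin] with x hux hvx
        have := wt_dual h.symm (hv.pos x) hvx (hu.pos x) hux
        simp only [Pi.mul_apply]
        rw [ENNReal.mul_rpow_of_nonneg _ _ (by linarith)]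
        unfold wt
        rw [← this]; ring
    _ = _ := by ring

/-! ### The Rubio de Francia algorithm -/

lemma mxl_mono (μ : Measure ℝ) {f g : ℝ → ℝ≥0∞} (h : ∀ x, f x ≤ g x) (x : ℝ) :
    mxl μ f x ≤ mxl μ g x := by
  refine mxl_le _ _ _ _ fun I hI => le_trans ?_ (avI_le_mxl _ _ I x hI)
  unfold avI
  gcongr with y
  exact h y

lemma mxl_tsum_le (μ : Measure ℝ) {f : ℕ → ℝ → ℝ≥0∞} (hf : ∀ k, Measurable (f k))
    (c : ℕ → ℝ≥0∞) (x : ℝ) :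
    mxl μ (fun y => ∑' k, c k * f k y) x ≤ ∑' k, c k * mxl μ (f k) x := by
  refine mxl_le _ _ _ _ fun I hI => ?_
  unfold avI
  rw [lintegral_tsum (fun k => ((hf k).const_mul _).aemeasurable), ← ENNReal.tsum_mul_left]
  refine ENNReal.tsum_le_tsum fun k => ?_
  rw [lintegral_const_mul _ (hf k), mul_left_comm]
  gcongr
  exact avI_le_mxl μ (f k) I x hI

/-- iterated maximal operators -/
def itm (G : ℝ → ℝ≥0∞) : ℕ → ℝ → ℝ≥0∞
  | 0 => G
  | k + 1 => mxl volume (itm G k)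

lemma itm_meas {G : ℝ → ℝ≥0∞} (hG : Measurable G) : ∀ k, Measurable (itm G k)
  | 0 => hG
  | _ + 1 => mxl_measurable _ _

/-- Rubio de Francia sum -/
def rdf (A : ℝ≥0∞) (G : ℝ → ℝ≥0∞) (x : ℝ) : ℝ≥0∞ := ∑' k, ((4 * A)⁻¹) ^ k * itm G k x

lemma rdf_meas (A : ℝ≥0∞) {G : ℝ → ℝ≥0∞} (hG : Measurable G) : Measurable (rdf A G) :=
  Measurable.tsum fun k => (itm_meas hG k).const_mul _

lemma le_rdf (A : ℝ≥0∞) (G : ℝ → ℝ≥0∞) (x : ℝ) : G x ≤ rdf A G x := by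
  refine le_trans ?_ (ENNReal.le_tsum 0)
  simp [itm]

lemma mxl_rdf {A : ℝ≥0∞} (hA : 1 ≤ A) (hA' : A ≠ ⊤) {G : ℝ → ℝ≥0∞} (hG : Measurable G) (x : ℝ) :
    mxl volume (rdf A G) x ≤ 4 * A * rdf A G x := by
  have h0 : 4 * A ≠ 0 := mul_ne_zero (by norm_num) (by positivity)
  have ht : 4 * A ≠ ⊤ := ENNReal.mul_ne_top (by norm_num) hA'
  refine le_trans (mxl_tsum_le volume (itm_meas hG) _ x) ?_
  unfold rdf
  rw [← ENNReal.tsum_mul_left]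
  have : ∀ k, ((4 * A)⁻¹) ^ k * mxl volume (itm G k) x
      = 4 * A * (((4 * A)⁻¹) ^ (k + 1) * itm G (k + 1) x) := by
    intro k
    rw [pow_succ, show 4 * A * ((4 * A)⁻¹ ^ k * (4 * A)⁻¹ * itm G (k + 1) x)
      = (4 * A * (4 * A)⁻¹) * ((4 * A)⁻¹ ^ k * itm G (k + 1) x) by ring,
      ENNReal.mul_inv_cancel h0 ht, one_mul]
    rfl
  simp_rw [this]
  exact ENNReal.tsum_comp_le_tsum_of_injective (f := fun k => k + 1) (add_left_injective 1)
    (fun k => 4 * A * (((4 * A)⁻¹) ^ k * itm G k x))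

lemma tsum_half : ∑' k : ℕ, ((2 : ℝ≥0∞)⁻¹) ^ k = 2 := by
  rw [ENNReal.tsum_geometric, ENNReal.one_sub_inv_two, inv_inv]

lemma rdf_rpow_le {A : ℝ≥0∞} (hA : 1 ≤ A) (hA' : A ≠ ⊤) (G : ℝ → ℝ≥0∞) {p : ℝ} (hp : 1 < p)
    (x : ℝ) : rdf A G x ^ p ≤ 2 ^ p * ∑' k, ((2 * A)⁻¹) ^ k * itm G k x ^ p := by
  have hp0 : 0 < p := by linarith
  set c : ℕ → ℝ≥0∞ := fun k => ((2 * A)⁻¹) ^ k * itm G k x with hc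
  have hle : (2 * A)⁻¹ ≤ 1 := by
    rw [ENNReal.inv_le_one]
    calc (1 : ℝ≥0∞) = 1 * 1 := by simp
      _ ≤ 2 * A := by gcongr; norm_num
  have h1 : rdf A G x ≤ 2 * (∑' k, c k ^ p) ^ p⁻¹ := by
    calc rdf A G x = ∑' k, (2⁻¹) ^ k * c k := by
          unfold rdf
          refine tsum_congr fun k => ?_
          rw [hc]
          simp only
          rw [← mul_assoc, ← mul_pow, ← ENNReal.mul_inv (by simp) (by simp), ← mul_assoc]
          norm_num
      _ ≤ ∑' k, (2⁻¹) ^ k * (∑' k, c k ^ p) ^ p⁻¹ := by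
          refine ENNReal.tsum_le_tsum fun k => ?_
          gcongr
          rw [ENNReal.le_rpow_inv_iff hp0]
          exact ENNReal.le_tsum k
      _ = _ := by rw [ENNReal.tsum_mul_right, tsum_half]
  calc rdf A G x ^ p ≤ (2 * (∑' k, c k ^ p) ^ p⁻¹) ^ p := by gcongr
    _ = 2 ^ p * ∑' k, c k ^ p := by
        rw [ENNReal.mul_rpow_of_nonneg _ _ hp0.le, ← ENNReal.rpow_mul, inv_mul_cancel₀ hp0.ne',
          ENNReal.rpow_one]
    _ ≤ _ := by
        gcongr with k
        rw [hc]
        simp only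
        rw [ENNReal.mul_rpow_of_nonneg _ _ hp0.le]
        gcongr
        apply ENNReal.rpow_le_self_of_le_one _ hp.le
        exact pow_le_one' hle k

lemma rdf_norm {A : ℝ≥0∞} (hA : 1 ≤ A) (hA' : A ≠ ⊤) {G : ℝ → ℝ≥0∞} (hG : Measurable G) {p : ℝ}
    (hp : 1 < p) {w : ℝ → ℝ≥0∞} (hw : Measurable w)
    (hM : ∀ f : ℝ → ℝ≥0∞, Measurable f → ∫⁻ x, mxl volume f x ^ p * w x ≤ A * ∫⁻ x, f x ^ p * w x) :
    ∫⁻ x, rdf A G x ^ p * w x ≤ 2 ^ p * 2 * ∫⁻ x, G x ^ p * w x := by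
  have hA0 : A ≠ 0 := by positivity
  have hit : ∀ k, ∫⁻ x, itm G k x ^ p * w x ≤ A ^ k * ∫⁻ x, G x ^ p * w x := by
    intro k
    induction k with
    | zero => simp [itm]
    | succ k ih =>
      refine (hM _ (itm_meas hG k)).trans ?_
      rw [pow_succ', mul_assoc]
      gcongr
  have hmm : ∀ k, Measurable fun x => itm G k x ^ p * w x := fun k =>
    ((itm_meas hG k).pow_const _).mul hw
  calc ∫⁻ x, rdf A G x ^ p * w x
      ≤ ∫⁻ x, 2 ^ p * ∑' k, ((2 * A)⁻¹) ^ k * (itm G k x ^ p * w x) := by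
        refine lintegral_mono fun x => ?_
        refine (mul_le_mul_left (rdf_rpow_le hA hA' G hp x) _).trans_eq ?_
        rw [mul_assoc, ← ENNReal.tsum_mul_right]
        simp_rw [mul_assoc]
    _ = 2 ^ p * ∑' k, ((2 * A)⁻¹) ^ k * ∫⁻ x, itm G k x ^ p * w x := by
        rw [lintegral_const_mul _ (Measurable.tsum fun k => (hmm k).const_mul _),
          lintegral_tsum fun k => ((hmm k).const_mul _).aemeasurable]
        congr 2
        ext k
        rw [lintegral_const_mul _ (hmm k)]
    _ ≤ 2 ^ p * ∑' k, (2⁻¹) ^ k * ∫⁻ x, G x ^ p * w x := by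
        refine mul_le_mul_right (ENNReal.tsum_le_tsum fun k => ?_) _
        refine (mul_le_mul_right (hit k) _).trans_eq ?_
        rw [← mul_assoc, ← mul_pow, ENNReal.mul_inv (by simp) (by simp), mul_assoc,
          ENNReal.inv_mul_cancel hA0 hA', mul_one]
    _ = _ := by rw [ENNReal.tsum_mul_right, tsum_half]; ring

lemma mxl_ne_zero {G : ℝ → ℝ≥0∞} (hG : Measurable G) (h : ¬ (∀ᵐ x, G x = 0)) (x : ℝ) :
    mxl volume G x ≠ 0 := by
  intro h0
  apply h
  have key : ∀ n : ℕ, ∀ᵐ y ∂(volume.restrict (Ioo (-(n : ℝ)) n)), G y = 0 := by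
    intro n
    obtain ⟨k, hk⟩ := exists_nat_gt |x|
    set N : ℕ := max n k
    have hnN : (n : ℝ) ≤ N := by exact_mod_cast le_max_left n k
    have hkN : (k : ℝ) ≤ N := by exact_mod_cast le_max_right n k
    set I : ℚ × ℚ := (-(N : ℚ), (N : ℚ)) with hI
    have hII : rI I = Ioo (-(N : ℝ)) N := by simp [rI, hI]
    have hx : x ∈ rI I := by
      rw [hII]
      have := abs_lt.mp (hk.trans_le hkN)
      exact this
    have h1 := avI_le_mxl volume G I x hx
    rw [h0] at h1
    have h2 : ∫⁻ y in rI I, G y = 0 := by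
      rw [int_eq_av _ _ _ (vol_rI hx).1 (vol_rI hx).2, le_antisymm h1 bot_le, mul_zero]
    rw [lintegral_eq_zero_iff hG] at h2
    refine ae_restrict_of_ae_restrict_of_subset ?_ h2
    rw [hII]
    exact Ioo_subset_Ioo (by linarith) hnN
  have h3 := (ae_restrict_iUnion_iff (μ := volume) (fun n : ℕ => Ioo (-(n : ℝ)) n) (fun y => G y = 0)).mpr key
  have : (⋃ n : ℕ, Ioo (-(n : ℝ)) n) = univ := by
    refine eq_univ_of_forall fun y => ?_
    obtain ⟨k, hk⟩ := exists_nat_gt |y|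
    exact mem_iUnion.mpr ⟨k, abs_lt.mp hk⟩
  rwa [this, Measure.restrict_univ] at h3

lemma rdf_A1 {A : ℝ≥0∞} (hA : 1 ≤ A) (hA' : A ≠ ⊤) {G : ℝ → ℝ≥0∞} (hG : Measurable G) {p : ℝ}
    (hp : 1 < p) {w : ℝ → ℝ≥0∞} (hw : Measurable w) (hw0 : ∀ᵐ x, w x ≠ 0)
    (hM : ∀ f : ℝ → ℝ≥0∞, Measurable f → ∫⁻ x, mxl volume f x ^ p * w x ≤ A * ∫⁻ x, f x ^ p * w x)
    (hfin : ∫⁻ x, G x ^ p * w x ≠ ⊤) (h : ¬ (∀ᵐ x, G x = 0)) :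
    A1w (4 * A) (rdf A G) where
  meas := rdf_meas A hG
  pos x := by
    intro h0
    have h1 := mxl_rdf hA hA' hG x
    rw [h0, mul_zero] at h1
    have h2 := (mxl_mono volume (le_rdf A G) x).trans h1
    exact mxl_ne_zero hG h x (le_antisymm h2 bot_le)
  fin := by
    have h1 : ∫⁻ x, rdf A G x ^ p * w x ≠ ⊤ := by
      refine ne_top_of_le_ne_top ?_ (rdf_norm hA hA' hG hp hw hM)
      refine ENNReal.mul_ne_top (ENNReal.mul_ne_top ?_ (by norm_num)) hfin
      exact ENNReal.rpow_ne_top_of_nonneg (by linarith) (by norm_num)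
    have h2 := ae_lt_top (((rdf_meas A hG).pow_const _).mul hw) h1
    filter_upwards [h2, hw0] with x hx hx0 ht
    simp only [Pi.mul_apply] at hx
    rw [ht, ENNReal.top_rpow_of_pos (by linarith), ENNReal.top_mul hx0] at hx
    exact lt_irrefl _ hx
  le := mxl_rdf hA hA' hG

lemma one_A1 {K : ℝ≥0∞} (hK : 1 ≤ K) : A1w K (fun _ => 1) where
  meas := measurable_const
  pos _ := one_ne_zero
  fin := by simp
  le x := by
    rw [mul_one]
    refine (mxl_le _ _ _ _ fun I _ => ?_).trans hK
    unfold avI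
    simp [ENNReal.inv_mul_le_one]

/-! ### Extrapolation -/

/-- The pairing bound. -/
lemma pairing {p0 p q : ℝ} (hp0 : 1 < p0) (hpq : p.HolderConjugate q) {B C0 : ℝ≥0∞} (hB : 1 ≤ B)
    (hB' : B ≠ ⊤) {w s : ℝ → ℝ≥0∞} (hw : Measurable w) (hs : Measurable s)
    (hwne : ∀ᵐ x, w x ≠ 0 ∧ w x ≠ ⊤) (hws : ∀ᵐ x, ((w x)⁻¹) ^ q * w x = s x)
    (hs0 : ∀ᵐ x, s x ≠ 0)
    (hM : ∀ f : ℝ → ℝ≥0∞, Measurable f → ∫⁻ x, mxl volume f x ^ p * w x ≤ B * ∫⁻ x, f x ^ p * w x)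
    (hM' : ∀ f : ℝ → ℝ≥0∞, Measurable f → ∫⁻ x, mxl volume f x ^ q * s x ≤ B * ∫⁻ x, f x ^ q * s x)
    {F G H : ℝ → ℝ≥0∞} (hF : Measurable F) (hG : Measurable G) (hH : Measurable H)
    (hG0 : ¬ (∀ᵐ x, G x = 0)) (hH0 : ¬ (∀ᵐ x, H x = 0))
    (hGf : ∫⁻ x, G x ^ p * w x ≠ ⊤) (hHf : ∫⁻ x, H x ^ q * s x ≠ ⊤)
    (hFG : ∀ u v, A1w (4 * B) u → A1w (4 * B) v →
      ∫⁻ x, F x ^ p0 * wt p0 u v x ≤ C0 * ∫⁻ x, G x ^ p0 * wt p0 u v x) :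
    ∫⁻ x, F x * H x ≤ C0 ^ (1 / p0) * ((2 ^ p * 2) ^ (1 / p) * (2 ^ q * 2) ^ (1 / q)) *
      ((∫⁻ x, G x ^ p * w x) ^ (1 / p) * (∫⁻ x, H x ^ q * s x) ^ (1 / q)) := by
  have h0 : p0.HolderConjugate (Real.conjExponent p0) := Real.HolderConjugate.conjExponent hp0
  set q0 := Real.conjExponent p0
  have aG := rdf_A1 hB hB' hG hpq.lt hw (hwne.mono fun x hx => hx.1) hM hGf hG0
  have aH := rdf_A1 hB hB' hH hpq.symm.lt hs hs0 hM' hHf hH0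
  have nG := rdf_norm hB hB' hG hpq.lt hw hM
  have nH := rdf_norm hB hB' hH hpq.symm.lt hs hM'
  have lG := le_rdf B G
  have lH := le_rdf B H
  have key := hFG _ _ aH aG
  set RG := rdf B G
  set RH := rdf B H
  have mG := aG.meas
  have mH := aH.meas
  have hp00 : 0 < p0 := h0.pos
  have hq00 : 0 < q0 := h0.symm.pos
  have hpp : 0 < p := hpq.pos
  have hqq : 0 < q := hpq.symm.pos
  have hinv : 1 / p0 + 1 / q0 = 1 := by
    have := h0.inv_add_inv_eq_one
    simpa [one_div] using this
  have hinv' : 1 / p + 1 / q = 1 := by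
    have := hpq.inv_add_inv_eq_one
    simpa [one_div] using this
  set T := ∫⁻ x, RG x * RH x with hT
  -- first step
  have s1 : ∫⁻ x, F x * H x ≤ C0 ^ (1 / p0) * T := by
    calc ∫⁻ x, F x * H x
        ≤ ∫⁻ x, ((fun x => F x * RG x ^ (-(1 / q0)) * RH x ^ (1 / p0)) *
            (fun x => RG x ^ (1 / q0) * RH x ^ (1 / q0))) x := by
          refine lintegral_mono_ae ?_
          filter_upwards [aG.fin] with x hx
          simp only [Pi.mul_apply]
          have e1 : RG x ^ (-(1 / q0)) * RG x ^ (1 / q0) = 1 := by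
            rw [← ENNReal.rpow_add _ _ (aG.pos x) hx]; simp
          have e2 : RH x ^ (1 / p0) * RH x ^ (1 / q0) = RH x := by
            rw [← ENNReal.rpow_add_of_nonneg _ _ (by positivity) (by positivity), hinv,
              ENNReal.rpow_one]
          calc F x * H x ≤ F x * RH x := by gcongr; exact lH x
            _ = F x * ((RG x ^ (-(1 / q0)) * RG x ^ (1 / q0)) * (RH x ^ (1 / p0) * RH x ^ (1 / q0))) := by
              rw [e1, e2, one_mul]
            _ = _ := by ring
            _ ≤ _ := le_rfl
      _ ≤ _ := ENNReal.lintegral_mul_le_Lp_mul_Lq volume h0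
            ((hF.mul (mG.pow_const _)).mul (mH.pow_const _)).aemeasurable
            ((mG.pow_const _).mul (mH.pow_const _)).aemeasurable
      _ = (∫⁻ x, F x ^ p0 * wt p0 RH RG x) ^ (1 / p0) * T ^ (1 / q0) := by
          congr 3
          · ext x
            unfold wt
            rw [ENNReal.mul_rpow_of_nonneg _ _ hp00.le, ENNReal.mul_rpow_of_nonneg _ _ hp00.le,
              ← ENNReal.rpow_mul, ← ENNReal.rpow_mul, one_div_mul_cancel hp00.ne', ENNReal.rpow_one,
              show -(1 / q0) * p0 = 1 - p0 by
                have : 1 / q0 = 1 - 1 / p0 := by linarith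
                rw [this]; field_simp; ring]
            ring
          · ext x
            rw [ENNReal.mul_rpow_of_nonneg _ _ hq00.le, ← ENNReal.rpow_mul, ← ENNReal.rpow_mul,
              one_div_mul_cancel hq00.ne', ENNReal.rpow_one, ENNReal.rpow_one]
      _ ≤ (C0 * T) ^ (1 / p0) * T ^ (1 / q0) := by
          gcongr
          refine key.trans ?_
          gcongr
          refine lintegral_mono_ae ?_
          filter_upwards [aG.fin] with x hx
          unfold wt
          calc G x ^ p0 * (RH x * RG x ^ (1 - p0)) ≤ RG x ^ p0 * (RH x * RG x ^ (1 - p0)) := by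
                gcongr
                exact lG x
            _ = (RG x ^ p0 * RG x ^ (1 - p0)) * RH x := by ring
            _ = RG x * RH x := by
                rw [← ENNReal.rpow_add _ _ (aG.pos x) hx]; simp
      _ = C0 ^ (1 / p0) * T := by
          rw [ENNReal.mul_rpow_of_nonneg _ _ (by positivity), mul_assoc,
            ← ENNReal.rpow_add_of_nonneg _ _ (by positivity) (by positivity), hinv, ENNReal.rpow_one]
  have s2 : T ≤ (∫⁻ x, RG x ^ p * w x) ^ (1 / p) * (∫⁻ x, RH x ^ q * s x) ^ (1 / q) := by
    calc T = ∫⁻ x, ((fun x => RG x * w x ^ (1 / p)) * (fun x => RH x * w x ^ (-(1 / p)))) x := by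
          refine lintegral_congr_ae ?_
          filter_upwards [hwne] with x hx
          simp only [Pi.mul_apply]
          rw [show RG x * w x ^ (1 / p) * (RH x * w x ^ (-(1 / p)))
            = RG x * RH x * (w x ^ (1 / p) * w x ^ (-(1 / p))) by ring,
            ← ENNReal.rpow_add _ _ hx.1 hx.2]
          simp
      _ ≤ _ := ENNReal.lintegral_mul_le_Lp_mul_Lq volume hpq
            (mG.mul (hw.pow_const _)).aemeasurable (mH.mul (hw.pow_const _)).aemeasurable
      _ = _ := by
          congr 2
          · refine lintegral_congr fun x => ?_
            rw [ENNReal.mul_rpow_of_nonneg _ _ hpp.le, ← ENNReal.rpow_mul,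
              one_div_mul_cancel hpp.ne', ENNReal.rpow_one]
          · refine lintegral_congr_ae ?_
            filter_upwards [hwne, hws] with x hx hx'
            rw [ENNReal.mul_rpow_of_nonneg _ _ hqq.le, ← ENNReal.rpow_mul, ← hx', ENNReal.inv_rpow,
              ← ENNReal.rpow_neg]
            nth_rewrite 3 [← ENNReal.rpow_one (w x)]
            rw [← ENNReal.rpow_add _ _ hx.1 hx.2]
            congr 2
            have : 1 / p = 1 - 1 / q := by linarith
            rw [this]; field_simp; ring
  calc ∫⁻ x, F x * H x ≤ C0 ^ (1 / p0) * T := s1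
    _ ≤ C0 ^ (1 / p0) * ((2 ^ p * 2 * ∫⁻ x, G x ^ p * w x) ^ (1 / p)
          * (2 ^ q * 2 * ∫⁻ x, H x ^ q * s x) ^ (1 / q)) := by
        gcongr
        refine s2.trans ?_
        gcongr
    _ = _ := by
        rw [ENNReal.mul_rpow_of_nonneg _ _ (show 0 ≤ 1 / p by positivity),
          ENNReal.mul_rpow_of_nonneg (2 ^ q * 2) _ (show 0 ≤ 1 / q by positivity)]
        ring

lemma lint0 {f w : ℝ → ℝ≥0∞} {p : ℝ} (hf : Measurable f) (hw : Measurable w) :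
    ∫⁻ x, f x ^ p * w x = 0 ↔ ∀ᵐ x, f x ^ p * w x = 0 :=
  lintegral_eq_zero_iff (f := fun x => f x ^ p * w x) ((hf.pow_const _).mul hw)

/-- Truncation of a function, used to make a weighted norm finite. -/
def trunc (F w : ℝ → ℝ≥0∞) (n : ℕ) (x : ℝ) : ℝ≥0∞ :=
  {x : ℝ | |x| ≤ n ∧ w x ≤ n}.indicator (fun x => min (F x) n) x

lemma trunc_meas {F w : ℝ → ℝ≥0∞} (hF : Measurable F) (hw : Measurable w) (n : ℕ) :
    Measurable (trunc F w n) := by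
  have h1 : MeasurableSet {x : ℝ | |x| ≤ n ∧ w x ≤ n} :=
    MeasurableSet.inter (s₁ := {x : ℝ | |x| ≤ n}) (s₂ := {x : ℝ | w x ≤ n})
      (measurableSet_le (f := fun x : ℝ => |x|) (by fun_prop) measurable_const)
      (measurableSet_le hw measurable_const)
  exact (hF.min measurable_const).indicator h1

lemma trunc_le (F w : ℝ → ℝ≥0∞) (n : ℕ) (x : ℝ) : trunc F w n x ≤ F x := by
  unfold trunc
  by_cases h : x ∈ {x : ℝ | |x| ≤ n ∧ w x ≤ n}
  · rw [indicator_of_mem h]; exact min_le_left _ _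
  · rw [indicator_of_notMem h]; exact bot_le

lemma trunc_fin (F w : ℝ → ℝ≥0∞) (n : ℕ) {p : ℝ} (hp : 0 < p) :
    ∫⁻ x, trunc F w n x ^ p * w x ≠ ⊤ := by
  have : ∫⁻ x, trunc F w n x ^ p * w x ≤ ∫⁻ x in Icc (-(n : ℝ)) n, (n : ℝ≥0∞) ^ p * n := by
    rw [← lintegral_indicator measurableSet_Icc]
    refine lintegral_mono fun x => ?_
    unfold trunc
    by_cases h : x ∈ {x : ℝ | |x| ≤ n ∧ w x ≤ n}
    · rw [indicator_of_mem h, indicator_of_mem (show x ∈ Icc (-(n : ℝ)) n from abs_le.mp h.1)]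
      gcongr
      · exact min_le_right _ _
      · exact h.2
    · rw [indicator_of_notMem h, ENNReal.zero_rpow_of_pos hp, zero_mul]
      exact bot_le
  refine ne_top_of_le_ne_top ?_ this
  rw [lintegral_const]
  refine ENNReal.mul_ne_top (ENNReal.mul_ne_top ?_ (by simp)) ?_
  · exact ENNReal.rpow_ne_top_of_nonneg hp.le (by simp)
  · simp [Real.volume_Icc]

lemma trunc_mono (F w : ℝ → ℝ≥0∞) (x : ℝ) : Monotone fun n => trunc F w n x := by
  intro a b hab
  have hR : (a : ℝ) ≤ b := by exact_mod_cast hab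
  have hE : (a : ℝ≥0∞) ≤ b := by exact_mod_cast hab
  simp only [trunc]
  by_cases h : x ∈ {x : ℝ | |x| ≤ a ∧ w x ≤ a}
  · rw [indicator_of_mem h, indicator_of_mem
      (show x ∈ {x : ℝ | |x| ≤ b ∧ w x ≤ b} from ⟨h.1.trans hR, h.2.trans hE⟩)]
    exact min_le_min_left _ hE
  · rw [indicator_of_notMem h]; exact bot_le

lemma trunc_sup (F w : ℝ → ℝ≥0∞) (x : ℝ) (hx : w x ≠ ⊤) {p : ℝ} (hp : 1 ≤ p) :
    F x ^ p * w x ≤ ⨆ n, trunc F w n x ^ p * w x := by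
  have hp0 : 0 < p := by linarith
  obtain ⟨n1, h1⟩ := exists_nat_ge |x|
  obtain ⟨n2, h2⟩ := ENNReal.exists_nat_gt hx
  have key : ∀ n : ℕ, min (F x) n ^ p * w x ≤ ⨆ n, trunc F w n x ^ p * w x := by
    intro n
    refine le_trans ?_ (le_iSup _ (max n (max n1 n2)))
    gcongr
    unfold trunc
    have hR : (n1 : ℝ) ≤ (max n (max n1 n2) : ℕ) := by
      exact_mod_cast (le_max_left _ _).trans (le_max_right _ _)
    have hE : (n2 : ℝ≥0∞) ≤ (max n (max n1 n2) : ℕ) := by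
      exact_mod_cast (le_max_right _ _).trans (le_max_right _ _)
    have hN : (n : ℝ≥0∞) ≤ (max n (max n1 n2) : ℕ) := by
      exact_mod_cast (le_max_left _ _)
    rw [indicator_of_mem (show x ∈ {x : ℝ | |x| ≤ (max n (max n1 n2) : ℕ) ∧
      w x ≤ (max n (max n1 n2) : ℕ)} from ⟨h1.trans hR, h2.le.trans hE⟩)]
    exact min_le_min_left _ hN
  by_cases hF : F x = ⊤
  · rw [hF, ENNReal.top_rpow_of_pos hp0, ← ENNReal.iSup_natCast, ENNReal.iSup_mul]
    refine iSup_le fun n => ?_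
    rcases Nat.eq_zero_or_pos n with hn | hn
    · simp [hn]
    refine le_trans ?_ (key n)
    rw [hF, min_eq_right le_top]
    gcongr
    exact ENNReal.le_rpow_self_of_one_le (by exact_mod_cast hn) hp
  · obtain ⟨n, hn⟩ := ENNReal.exists_nat_gt hF
    have := key n
    rwa [min_eq_left hn.le] at this

lemma le_of_trunc {F w : ℝ → ℝ≥0∞} (hF : Measurable F) (hw : Measurable w) (hx : ∀ᵐ x, w x ≠ ⊤)
    {p : ℝ} (hp : 1 ≤ p) {c : ℝ≥0∞} (h : ∀ n, ∫⁻ x, trunc F w n x ^ p * w x ≤ c) :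
    ∫⁻ x, F x ^ p * w x ≤ c := by
  calc ∫⁻ x, F x ^ p * w x ≤ ∫⁻ x, ⨆ n, trunc F w n x ^ p * w x := by
        refine lintegral_mono_ae ?_
        filter_upwards [hx] with x hx using trunc_sup F w x hx hp
    _ = ⨆ n, ∫⁻ x, trunc F w n x ^ p * w x := by
        refine lintegral_iSup (fun n => ((trunc_meas hF hw n).pow_const _).mul hw) ?_
        intro a b hab x
        have := trunc_mono F w x hab
        simp only at this ⊢
        gcongr
    _ ≤ c := iSup_le h

lemma extrap {p0 p : ℝ} (hp0 : 1 < p0) (hp : 1 < p)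
    (P : (ℝ → ℝ≥0∞) → (ℝ → ℝ≥0∞) → Prop)
    (hmeas : ∀ F G, P F G → Measurable F ∧ Measurable G)
    (hyp : ∀ K : ℝ≥0∞, K ≠ ⊤ → K ≠ 0 → ∃ C : ℝ≥0∞, C ≠ ⊤ ∧ ∀ F G, P F G → ∀ u v, A1w K u → A1w K v →
      ∫⁻ x, F x ^ p0 * wt p0 u v x ≤ C * ∫⁻ x, G x ^ p0 * wt p0 u v x) :
    ∀ K : ℝ≥0∞, K ≠ ⊤ → K ≠ 0 → ∃ C : ℝ≥0∞, C ≠ ⊤ ∧ ∀ F G, P F G → ∀ u v, A1w K u → A1w K v →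
      ∫⁻ x, F x ^ p * wt p u v x ≤ C * ∫⁻ x, G x ^ p * wt p u v x := by
  intro K hK hK0
  have hpq : p.HolderConjugate (Real.conjExponent p) := Real.HolderConjugate.conjExponent hp
  set q := Real.conjExponent p
  have hpp : 0 < p := hpq.pos
  have hqq : 0 < q := hpq.symm.pos
  obtain ⟨A, hA, hA1, hMA⟩ := muck hp hK hK0
  obtain ⟨A', hA', hA1', hMA'⟩ := muck hpq.symm.lt hK hK0
  set B := max A A' with hB
  have hB1 : 1 ≤ B := hA1.trans (le_max_left _ _)
  have hBT : B ≠ ⊤ := (max_lt hA.lt_top hA'.lt_top).ne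
  have h4B : 1 ≤ 4 * B := by
    calc (1 : ℝ≥0∞) = 1 * 1 := by simp
      _ ≤ 4 * B := by gcongr; norm_num
  obtain ⟨C0, hC0, hC⟩ := hyp (4 * B) (ENNReal.mul_ne_top (by norm_num) hBT) (by positivity)
  set D := C0 ^ (1 / p0) * ((2 ^ p * 2) ^ (1 / p) * (2 ^ q * 2) ^ (1 / q)) with hD
  have hDT : D ≠ ⊤ := by
    refine ENNReal.mul_ne_top (ENNReal.rpow_ne_top_of_nonneg (by positivity) hC0)
      (ENNReal.mul_ne_top ?_ ?_)
    · exact ENNReal.rpow_ne_top_of_nonneg (by positivity) (ENNReal.mul_ne_top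
        (ENNReal.rpow_ne_top_of_nonneg (by positivity) (by norm_num)) (by norm_num))
    · exact ENNReal.rpow_ne_top_of_nonneg (by positivity) (ENNReal.mul_ne_top
        (ENNReal.rpow_ne_top_of_nonneg (by positivity) (by norm_num)) (by norm_num))
  refine ⟨max 1 (D ^ p), ?_, ?_⟩
  · exact (max_lt (by norm_num) (ENNReal.rpow_ne_top_of_nonneg hpp.le hDT).lt_top).ne
  intro F G hFG u v hu hv
  obtain ⟨hF, hG⟩ := hmeas F G hFG
  have hwm : Measurable (wt p u v) := wt_meas hu.meas hv.meas
  have hsm : Measurable (wt q v u) := wt_meas hv.meas hu.meas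
  by_cases hGf : ∫⁻ x, G x ^ p * wt p u v x = ⊤
  · rw [hGf, ENNReal.mul_top]
    · exact le_top
    · exact (lt_of_lt_of_le one_pos (le_max_left _ _)).ne'
  by_cases hG0 : ∀ᵐ x, G x = 0
  · have h1 := hC F G hFG _ _ (one_A1 h4B) (one_A1 h4B)
    have h2 : ∫⁻ x, G x ^ p0 * wt p0 (fun _ => 1) (fun _ => 1) x = 0 := by
      rw [lint0 hG (wt_meas measurable_const measurable_const)]
      filter_upwards [hG0] with x hx
      simp only [hx, ENNReal.zero_rpow_of_pos (show 0 < p0 by linarith), zero_mul, Pi.zero_apply]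
    rw [h2, mul_zero, le_zero_iff,
      lint0 hF (wt_meas measurable_const measurable_const)] at h1
    have h3 : ∫⁻ x, F x ^ p * wt p u v x = 0 := by
      rw [lint0 hF hwm]
      filter_upwards [h1] with x hx
      simp [wt, ENNReal.rpow_eq_zero_iff, show 0 < p0 by linarith, show ¬ (p0 < 0) by linarith] at hx
      simp [hx, ENNReal.zero_rpow_of_pos hpp]
    rw [h3]; exact bot_le
  refine le_trans ?_ (mul_le_mul_left (le_max_right _ _) _)
  refine le_of_trunc hF hwm ((wt_ae hu hv).mono fun x hx => hx.2) hp.le fun n => ?_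
  set X := ∫⁻ x, trunc F (wt p u v) n x ^ p * wt p u v x with hX
  by_cases hX0 : X = 0
  · rw [hX0]; exact bot_le
  have hXT : X ≠ ⊤ := trunc_fin _ _ _ hpp
  have tm := trunc_meas hF hwm n
  set t := trunc F (wt p u v) n with ht
  set H : ℝ → ℝ≥0∞ := fun x => t x ^ (p - 1) * wt p u v x with hH
  have hHm : Measurable H := (tm.pow_const _).mul hwm
  have hws : ∀ᵐ x, ((wt p u v x)⁻¹) ^ q * wt p u v x = wt q v u x := by
    filter_upwards [hu.fin, hv.fin] with x hux hvx
    exact wt_dual hpq (hu.pos x) hux (hv.pos x) hvx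
  have hpq1 : (p - 1) * q = p := by have := hpq.mul_eq_add; linarith
  have hsplit : ∀ a : ℝ≥0∞, a * a ^ (p - 1) = a ^ p := by
    intro a
    conv_lhs => rw [← ENNReal.rpow_one a, ← ENNReal.rpow_mul, one_mul,
            ← ENNReal.rpow_add_of_nonneg _ _ zero_le_one (by linarith)]
    congr 1; ring
  have hJ : ∫⁻ x, H x ^ q * wt q v u x = X := by
    refine lintegral_congr_ae ?_
    filter_upwards [hws, wt_ae (p := p) hu hv] with x hx hx'
    rw [← hx, hH]
    simp only
    rw [ENNReal.mul_rpow_of_nonneg _ _ hqq.le, ← ENNReal.rpow_mul, hpq1, ENNReal.inv_rpow]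
    rw [show t x ^ p * wt p u v x ^ q * ((wt p u v x ^ q)⁻¹ * wt p u v x)
      = t x ^ p * (wt p u v x ^ q * (wt p u v x ^ q)⁻¹) * wt p u v x by ring]
    rw [ENNReal.mul_inv_cancel, mul_one]
    · simp [ENNReal.rpow_eq_zero_iff, hx'.1, hx'.2]
    · exact ENNReal.rpow_ne_top_of_nonneg hqq.le hx'.2
  have hlow : X ≤ ∫⁻ x, F x * H x := by
    refine lintegral_mono fun x => ?_
    rw [hH]
    simp only
    rw [← mul_assoc, ← hsplit]
    gcongr
    exact trunc_le _ _ _ _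
  have hH0 : ¬ (∀ᵐ x, H x = 0) := by
    intro h0
    apply hX0
    rw [← hJ, lint0 hHm hsm]
    filter_upwards [h0] with x hx
    simp only [hx, ENNReal.zero_rpow_of_pos hqq, zero_mul, Pi.zero_apply]
  have main := pairing hp0 hpq hB1 hBT hwm hsm (wt_ae hu hv) hws
    ((wt_ae (p := q) hv hu).mono fun x hx => hx.1)
    (fun f hf => (hMA u v hu hv f hf).trans (mul_le_mul_left (le_max_left _ _) _))
    (fun f hf => (hMA' v u hv hu f hf).trans (mul_le_mul_left (le_max_right _ _) _))
    hF hG hHm hG0 hH0 hGf (hJ ▸ hXT) (hC F G hFG)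
  rw [hJ, ← hD] at main
  set I := ∫⁻ x, G x ^ p * wt p u v x with hI
  have m1 : X ≤ D * I ^ (1 / p) * X ^ (1 / q) := by
    rw [mul_assoc]; exact hlow.trans main
  have hinv' : 1 / p + 1 / q = 1 := by
    have := hpq.inv_add_inv_eq_one
    simpa [one_div] using this
  have m2 : X ^ (1 / p) * X ^ (1 / q) ≤ D * I ^ (1 / p) * X ^ (1 / q) := by
    rwa [← ENNReal.rpow_add_of_nonneg _ _ (by positivity) (by positivity), hinv', ENNReal.rpow_one]
  have m3 : X ^ (1 / p) ≤ D * I ^ (1 / p) := by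
    refine (ENNReal.mul_le_mul_iff_left ?_ ?_).mp m2
    · simp [ENNReal.rpow_eq_zero_iff, hX0, hXT]
    · exact ENNReal.rpow_ne_top_of_nonneg (by positivity) hXT
  have m4 := ENNReal.rpow_le_rpow m3 hpp.le
  rwa [ENNReal.mul_rpow_of_nonneg _ _ hpp.le, ← ENNReal.rpow_mul, ← ENNReal.rpow_mul,
    one_div_mul_cancel hpp.ne', ENNReal.rpow_one, ENNReal.rpow_one] at m4

/-! ### Mixed norms: measurability, monotonicity, homogeneity -/

lemma snoc_meas (n : ℕ) : Measurable (fun p : (Fin n → ℝ) × ℝ => (Fin.snoc p.1 p.2 : Fin (n + 1) → ℝ)) := by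
  refine measurable_pi_iff.2 fun i => ?_
  refine Fin.lastCases ?_ (fun j => ?_) i
  · simp only [Fin.snoc_last]; exact measurable_snd
  · simp only [Fin.snoc_castSucc]; exact (measurable_pi_apply j).comp measurable_fst

lemma init_meas (n : ℕ) : Measurable (fun x : Fin (n + 1) → ℝ => (Fin.init x : Fin n → ℝ)) := by
  refine measurable_pi_iff.2 fun i => ?_
  exact measurable_pi_apply _

lemma mL_meas : ∀ (n : ℕ) (q : Fin n → ℝ) {α : Type} [MeasurableSpace α]
    (g : α × (Fin n → ℝ) → ℝ≥0∞), Measurable g →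
    Measurable (fun a => mixedLnorm n q (fun y => g (a, y)))
  | 0, q, α, _, g, hg => by
    simp only [mixedLnorm]
    exact hg.comp (measurable_id.prodMk measurable_const)
  | n + 1, q, α, _, g, hg => by
    simp only [mixedLnorm]
    refine Measurable.pow_const ?_ _
    have h1 : Measurable (fun z : (α × ℝ) × (Fin n → ℝ) =>
        g (z.1.1, (Fin.snoc z.2 z.1.2 : Fin (n + 1) → ℝ))) := by
      refine hg.comp (Measurable.prodMk (by fun_prop) ?_)
      exact (snoc_meas n).comp (measurable_snd.prodMk (by fun_prop))
    have h2 := mL_meas n (fun i => q i.castSucc) _ h1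
    exact Measurable.lintegral_prod_right' (f := fun z : α × ℝ =>
      mixedLnorm n (fun i => q i.castSucc) (fun y => g (z.1, (Fin.snoc y z.2 : Fin (n + 1) → ℝ)))
        ^ q (Fin.last n)) (h2.pow_const _)

lemma mL_mono : ∀ (n : ℕ) (q : Fin n → ℝ), (∀ j, 0 < q j) → ∀ (g h : (Fin n → ℝ) → ℝ≥0∞),
    (∀ x, g x ≤ h x) → mixedLnorm n q g ≤ mixedLnorm n q h
  | 0, q, hq, g, h, H => by
    simp only [mixedLnorm]; exact H _
  | n + 1, q, hq, g, h, H => by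
    simp only [mixedLnorm]
    have h0 := hq (Fin.last n)
    refine ENNReal.rpow_le_rpow (lintegral_mono fun t => ?_) (by positivity)
    exact ENNReal.rpow_le_rpow (mL_mono n _ (fun j => hq _) _ _ fun y => H _) h0.le

lemma mL_const : ∀ (n : ℕ) (q : Fin n → ℝ), (∀ j, 0 < q j) → ∀ (c : ℝ≥0∞), c ≠ ⊤ →
    ∀ (g : (Fin n → ℝ) → ℝ≥0∞),
    mixedLnorm n q (fun x => c * g x) = c * mixedLnorm n q g
  | 0, q, hq, c, hc, g => by
    simp only [mixedLnorm]
  | n + 1, q, hq, c, hc, g => by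
    simp only [mixedLnorm]
    have h0 := hq (Fin.last n)
    simp_rw [mL_const n (fun i => q i.castSucc) (fun j => hq _) c hc, ENNReal.mul_rpow_of_nonneg _ _ h0.le]
    rw [lintegral_const_mul' _ _ (ENNReal.rpow_ne_top_of_nonneg h0.le hc),
      ENNReal.mul_rpow_of_nonneg _ _ (by positivity), ← ENNReal.rpow_mul]
    rw [mul_one_div_cancel h0.ne', ENNReal.rpow_one]

/-! ### Vector-valued maximal inequality -/

lemma mxl_param {α : Type} [MeasurableSpace α] (g : α × ℝ → ℝ≥0∞) (hg : Measurable g) :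
    Measurable (fun z : α × ℝ => mxl volume (fun s => g (z.1, s)) z.2) := by
  unfold mxl
  refine Measurable.iSup fun I => ?_
  have h1 : Measurable (fun z : α × ℝ => avI volume (fun s => g (z.1, s)) I) := by
    unfold avI
    refine Measurable.const_mul ?_ _
    have : Measurable (fun a : α => ∫⁻ s in rI I, g (a, s)) := hg.lintegral_prod_right'
    exact this.comp measurable_fst
  exact h1.indicator (measurable_snd (rI_meas I))

/-- The pairs of functions to which the vector-valued inequality applies. -/
def VP (j : ℕ) (Q : Fin j → ℝ) (F G : ℝ → ℝ≥0∞) : Prop :=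
  ∃ g : (Fin j → ℝ) × ℝ → ℝ≥0∞, Measurable g ∧
    F = (fun t => mixedLnorm j Q (fun y => mxl volume (fun s => g (y, s)) t)) ∧
    G = (fun t => mixedLnorm j Q (fun y => g (y, t)))

lemma VP_meas (j : ℕ) (Q : Fin j → ℝ) (F G : ℝ → ℝ≥0∞) (h : VP j Q F G) :
    Measurable F ∧ Measurable G := by
  obtain ⟨g, hg, rfl, rfl⟩ := h
  constructor
  · exact mL_meas j Q (fun z : ℝ × (Fin j → ℝ) => mxl volume (fun s => g (z.2, s)) z.1)
      ((mxl_param g hg).comp measurable_swap)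
  · exact mL_meas j Q (fun z : ℝ × (Fin j → ℝ) => g (z.2, z.1)) (hg.comp measurable_swap)

lemma VV : ∀ (j : ℕ) (Q : Fin j → ℝ), (∀ i, 1 < Q i) → ∀ (p : ℝ), 1 < p →
    ∀ K : ℝ≥0∞, K ≠ ⊤ → K ≠ 0 → ∃ C : ℝ≥0∞, C ≠ ⊤ ∧ ∀ F G, VP j Q F G →
      ∀ u v, A1w K u → A1w K v →
        ∫⁻ x, F x ^ p * wt p u v x ≤ C * ∫⁻ x, G x ^ p * wt p u v x
  | 0, Q, hQ, p, hp, K, hK, hK0 => by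
    obtain ⟨A, hA, _, h⟩ := muck hp hK hK0
    refine ⟨A, hA, ?_⟩
    rintro F G ⟨g, hg, rfl, rfl⟩ u v hu hv
    simp only [mixedLnorm]
    exact h u v hu hv _ (hg.comp (measurable_const.prodMk measurable_id))
  | j + 1, Q, hQ, p, hp, K, hK, hK0 => by
    have h0 := hQ (Fin.last j)
    have h00 : 0 < Q (Fin.last j) := by linarith
    refine extrap h0 hp (VP (j + 1) Q) (VP_meas _ _) ?_ K hK hK0
    intro K hK hK0
    obtain ⟨C, hC, h⟩ := VV j (fun i => Q i.castSucc) (fun i => hQ _) _ h0 K hK hK0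
    refine ⟨C, hC, ?_⟩
    rintro F G ⟨g, hg, rfl, rfl⟩ u v hu hv
    have hw : Measurable (wt (Q (Fin.last j)) u v) := wt_meas hu.meas hv.meas
    simp only [mixedLnorm, ← ENNReal.rpow_mul]
    rw [one_div_mul_cancel h00.ne']
    simp only [ENNReal.rpow_one]
    set p0 := Q (Fin.last j)
    set Q' := fun i : Fin j => Q i.castSucc
    have hg' : Measurable (fun z : ((Fin j → ℝ) × ℝ) × ℝ =>
        g ((Fin.snoc z.1.1 z.1.2 : Fin (j + 1) → ℝ), z.2)) :=
      hg.comp (((snoc_meas j).comp measurable_fst).prodMk measurable_snd)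
    have m1 : Measurable (fun z : ℝ × ℝ =>
        mixedLnorm j Q' (fun y => mxl volume (fun s => g ((Fin.snoc y z.2 : Fin (j + 1) → ℝ), s)) z.1)) := by
      refine mL_meas j Q' (fun z : (ℝ × ℝ) × (Fin j → ℝ) =>
        mxl volume (fun s => g ((Fin.snoc z.2 z.1.2 : Fin (j + 1) → ℝ), s)) z.1.1) ?_
      exact (mxl_param _ hg').comp
        (((measurable_snd).prodMk (by fun_prop)).prodMk (by fun_prop) :
          Measurable (fun z : (ℝ × ℝ) × (Fin j → ℝ) => ((z.2, z.1.2), z.1.1)))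
    have m2 : Measurable (fun z : ℝ × ℝ =>
        mixedLnorm j Q' (fun y => g ((Fin.snoc y z.2 : Fin (j + 1) → ℝ), z.1))) := by
      refine mL_meas j Q' (fun z : (ℝ × ℝ) × (Fin j → ℝ) =>
        g ((Fin.snoc z.2 z.1.2 : Fin (j + 1) → ℝ), z.1.1)) ?_
      exact hg'.comp
        (((measurable_snd).prodMk (by fun_prop)).prodMk (by fun_prop) :
          Measurable (fun z : (ℝ × ℝ) × (Fin j → ℝ) => ((z.2, z.1.2), z.1.1)))
    have tonelli : ∀ Φ : ℝ × ℝ → ℝ≥0∞, Measurable Φ →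
        ∫⁻ x, (∫⁻ t, Φ (x, t) ^ p0) * wt p0 u v x = ∫⁻ t, (∫⁻ x, Φ (x, t) ^ p0 * wt p0 u v x) := by
      intro Φ hΦ
      rw [lintegral_lintegral_swap (f := fun t x => Φ (x, t) ^ p0 * wt p0 u v x)]
      · refine lintegral_congr fun x => ?_
        rw [lintegral_mul_const]
        exact (hΦ.comp (measurable_const.prodMk measurable_id)).pow_const _
      · refine Measurable.aemeasurable ?_
        exact ((hΦ.comp measurable_swap).pow_const _).mul (hw.comp measurable_snd)
    have t1 := tonelli _ m1
    have t2 := tonelli _ m2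
    simp only at t1 t2
    rw [t1, t2, ← lintegral_const_mul' _ _ hC]
    refine lintegral_mono fun t => ?_
    refine h _ _ ⟨fun z => g ((Fin.snoc z.1 t : Fin (j + 1) → ℝ), z.2), ?_, rfl, rfl⟩ u v hu hv
    exact hg'.comp ((measurable_fst.prodMk measurable_const).prodMk measurable_snd :
      Measurable (fun z : (Fin j → ℝ) × ℝ => ((z.1, t), z.2)))

/-! ### The strong maximal operator -/

/-- Iterated one-dimensional maximal operators. -/
def SM : (n : ℕ) → ((Fin n → ℝ) → ℝ≥0∞) → (Fin n → ℝ) → ℝ≥0∞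
  | 0, g, x => g x
  | n + 1, g, x => mxl volume (fun s => SM n (fun y => g (Fin.snoc y s)) (Fin.init x)) (x (Fin.last n))

lemma SM_meas : ∀ (n : ℕ) {α : Type} [MeasurableSpace α]
    (g : α × (Fin n → ℝ) → ℝ≥0∞), Measurable g →
    Measurable (fun z : α × (Fin n → ℝ) => SM n (fun y => g (z.1, y)) z.2)
  | 0, α, _, g, hg => by simpa only [SM] using hg
  | n + 1, α, _, g, hg => by
    simp only [SM]
    have h1 : Measurable (fun z : (α × ℝ) × (Fin n → ℝ) =>
        g (z.1.1, (Fin.snoc z.2 z.1.2 : Fin (n + 1) → ℝ))) := by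
      refine hg.comp (Measurable.prodMk (by fun_prop) ?_)
      exact (snoc_meas n).comp (measurable_snd.prodMk (by fun_prop))
    have h2 := SM_meas n _ h1
    have h3 := mxl_param (fun w : (α × (Fin n → ℝ)) × ℝ =>
      SM n (fun y => g (w.1.1, (Fin.snoc y w.2 : Fin (n + 1) → ℝ))) w.1.2)
      (h2.comp ((Measurable.prodMk (by fun_prop) (by fun_prop)).prodMk (by fun_prop) :
        Measurable (fun w : (α × (Fin n → ℝ)) × ℝ => ((w.1.1, w.2), w.1.2))))
    exact h3.comp ((measurable_fst.prodMk ((init_meas n).comp measurable_snd)).prodMk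
      ((measurable_pi_apply (Fin.last n)).comp measurable_snd) :
        Measurable (fun z : α × (Fin (n + 1) → ℝ) => ((z.1, (Fin.init z.2 : Fin n → ℝ)), z.2 (Fin.last n))))

lemma SM_bdd : ∀ (n : ℕ) (Q : Fin n → ℝ), (∀ i, 1 < Q i) → ∃ C : ℝ≥0∞, C ≠ ⊤ ∧
    ∀ g : (Fin n → ℝ) → ℝ≥0∞, Measurable g →
      mixedLnorm n Q (SM n g) ≤ C * mixedLnorm n Q g
  | 0, Q, hQ => ⟨1, by simp, fun g hg => by simp [mixedLnorm, SM]⟩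
  | n + 1, Q, hQ => by
    obtain ⟨C', hC', h'⟩ := SM_bdd n (fun i => Q i.castSucc) (fun i => hQ _)
    obtain ⟨C, hC, h⟩ := VV n (fun i => Q i.castSucc) (fun i => hQ _) _ (hQ (Fin.last n)) 1
      (by simp) (by simp)
    have h0 : 0 < Q (Fin.last n) := by linarith [hQ (Fin.last n)]
    refine ⟨(C * C' ^ Q (Fin.last n)) ^ (1 / Q (Fin.last n)), ?_, ?_⟩
    · exact ENNReal.rpow_ne_top_of_nonneg (by positivity)
        (ENNReal.mul_ne_top hC (ENNReal.rpow_ne_top_of_nonneg h0.le hC'))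
    intro g hg
    simp only [mixedLnorm, SM, Fin.init_snoc, Fin.snoc_last]
    rw [← ENNReal.mul_rpow_of_nonneg _ _ (by positivity)]
    refine ENNReal.rpow_le_rpow ?_ (by positivity)
    have hgm : Measurable (fun z : ℝ × (Fin n → ℝ) => g (Fin.snoc z.2 z.1)) :=
      hg.comp ((snoc_meas n).comp measurable_swap)
    have k := h _ _ ⟨fun z => SM n (fun y => g (Fin.snoc y z.2)) z.1,
      (SM_meas n _ hgm).comp measurable_swap, rfl, rfl⟩ _ _ (one_A1 le_rfl) (one_A1 le_rfl)
    simp only [wt, ENNReal.one_rpow, mul_one] at k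
    refine k.trans ?_
    rw [mul_assoc, ← lintegral_const_mul' _ _ (ENNReal.rpow_ne_top_of_nonneg h0.le hC')]
    refine mul_le_mul_right (lintegral_mono fun t => ?_) _
    rw [← ENNReal.mul_rpow_of_nonneg _ _ h0.le]
    refine ENNReal.rpow_le_rpow ?_ h0.le
    exact h' _ (hgm.comp (measurable_const.prodMk measurable_id))

/-! ### Averages over boxes and balls -/

/-- The open box with centre `x` and half-side `r`. -/
def bx (n : ℕ) (x : Fin n → ℝ) (r : ℝ) : Set (Fin n → ℝ) :=
  Set.univ.pi fun i => Ioo (x i - r) (x i + r)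

lemma bx_meas (n : ℕ) (x : Fin n → ℝ) (r : ℝ) : MeasurableSet (bx n x r) :=
  MeasurableSet.univ_pi fun _ => measurableSet_Ioo

lemma lint_snoc (n : ℕ) (f : (Fin (n + 1) → ℝ) → ℝ≥0∞) (hf : Measurable f) :
    ∫⁻ y, f y = ∫⁻ t : ℝ, (∫⁻ y : Fin n → ℝ, f (Fin.snoc y t)) := by
  have h := (volume_preserving_piFinSuccAbove (fun _ : Fin (n + 1) => ℝ) (Fin.last n)).symm
  rw [MeasurePreserving.lintegral_map_equiv f _ h]
  have e : ∀ z : ℝ × (Fin n → ℝ),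
      (MeasurableEquiv.piFinSuccAbove (fun _ : Fin (n + 1) => ℝ) (Fin.last n)).symm z
        = (Fin.snoc z.2 z.1 : Fin (n + 1) → ℝ) := by
    intro z
    rw [MeasurableEquiv.piFinSuccAbove_symm_apply]
    exact Fin.insertNth_last' z.1 z.2
  simp_rw [e]
  exact lintegral_prod (fun z : ℝ × (Fin n → ℝ) => f (Fin.snoc z.2 z.1))
    (hf.comp ((snoc_meas n).comp measurable_swap)).aemeasurable

lemma one_box (h : ℝ → ℝ≥0∞) (x r : ℝ) (hr : 0 < r) :
    ∫⁻ t in Ioo (x - r) (x + r), h t ≤ ENNReal.ofReal (4 * r) * mxl volume h x := by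
  obtain ⟨a, ha1, ha2⟩ := exists_rat_btwn (show x - 2 * r < x - r by linarith)
  obtain ⟨b, hb1, hb2⟩ := exists_rat_btwn (show x + r < x + 2 * r by linarith)
  have hx : x ∈ rI (a, b) := ⟨by simp only; linarith, by simp only; linarith⟩
  have hs : Ioo (x - r) (x + r) ⊆ rI (a, b) := by
    intro t ht
    exact ⟨by simp only; linarith [ht.1], by simp only; linarith [ht.2]⟩
  refine (lintegral_mono_set hs).trans ?_
  obtain ⟨v0, vt⟩ := vol_rI hx
  rw [int_eq_av _ _ _ v0 vt]
  refine mul_le_mul' ?_ (avI_le_mxl _ _ _ _ hx)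
  unfold rI
  rw [Real.volume_Ioo]
  refine ENNReal.ofReal_le_ofReal ?_
  simp only
  linarith

lemma box_le : ∀ (n : ℕ) (x : Fin n → ℝ) (r : ℝ), 0 < r → ∀ g : (Fin n → ℝ) → ℝ≥0∞,
    Measurable g → ∫⁻ y in bx n x r, g y ≤ ENNReal.ofReal (4 * r) ^ n * SM n g x
  | 0, x, r, hr, g, hg => by
    refine (setLIntegral_le_lintegral _ _).trans ?_
    rw [volume_pi, Measure.pi_of_empty _ x, lintegral_dirac]
    simp [SM]
  | n + 1, x, r, hr, g, hg => by
    rw [← lintegral_indicator (bx_meas _ _ _), lint_snoc n _ (hg.indicator (bx_meas _ _ _))]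
    have e : ∀ (t : ℝ) (y : Fin n → ℝ), (bx (n + 1) x r).indicator g (Fin.snoc y t)
        = (Ioo (x (Fin.last n) - r) (x (Fin.last n) + r)).indicator
          (fun t => (bx n (Fin.init x) r).indicator (fun y => g (Fin.snoc y t)) y) t := by
      intro t y
      have : (Fin.snoc y t : Fin (n + 1) → ℝ) ∈ bx (n + 1) x r ↔
          t ∈ Ioo (x (Fin.last n) - r) (x (Fin.last n) + r) ∧ y ∈ bx n (Fin.init x) r := by
        simp only [bx, Set.mem_univ_pi]
        rw [Fin.forall_fin_succ']
        simp only [Fin.snoc_castSucc, Fin.snoc_last, Fin.init]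
        exact and_comm
      by_cases h1 : t ∈ Ioo (x (Fin.last n) - r) (x (Fin.last n) + r)
      · rw [indicator_of_mem h1]
        by_cases h2 : y ∈ bx n (Fin.init x) r
        · rw [indicator_of_mem h2, indicator_of_mem (this.2 ⟨h1, h2⟩)]
        · rw [indicator_of_notMem h2, indicator_of_notMem (fun h => h2 (this.1 h).2)]
      · rw [indicator_of_notMem h1, indicator_of_notMem (fun h => h1 (this.1 h).1)]
    have hgm : Measurable (fun z : ℝ × (Fin n → ℝ) => g (Fin.snoc z.2 z.1)) :=
      hg.comp ((snoc_meas n).comp measurable_swap)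
    calc ∫⁻ t : ℝ, (∫⁻ y : Fin n → ℝ, (bx (n + 1) x r).indicator g (Fin.snoc y t))
        ≤ ∫⁻ t : ℝ, (Ioo (x (Fin.last n) - r) (x (Fin.last n) + r)).indicator
          (fun t => ENNReal.ofReal (4 * r) ^ n * SM n (fun y => g (Fin.snoc y t)) (Fin.init x)) t := by
          refine lintegral_mono fun t => ?_
          simp_rw [e]
          by_cases h1 : t ∈ Ioo (x (Fin.last n) - r) (x (Fin.last n) + r)
          · simp only [indicator_of_mem h1]
            rw [lintegral_indicator (bx_meas _ _ _)]
            exact box_le n _ r hr _ (hgm.comp (measurable_const.prodMk measurable_id))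
          · simp [indicator_of_notMem h1]
      _ = ENNReal.ofReal (4 * r) ^ n * ∫⁻ t in Ioo (x (Fin.last n) - r) (x (Fin.last n) + r),
            SM n (fun y => g (Fin.snoc y t)) (Fin.init x) := by
          rw [lintegral_indicator measurableSet_Ioo,
            lintegral_const_mul' _ _ (ENNReal.pow_ne_top ENNReal.ofReal_ne_top)]
      _ ≤ ENNReal.ofReal (4 * r) ^ n * (ENNReal.ofReal (4 * r) * SM (n + 1) g x) :=
          mul_le_mul_right (one_box _ _ _ hr) _
      _ = _ := by rw [pow_succ, mul_assoc]

lemma eball_sub_bx (n : ℕ) (x : Fin n → ℝ) (r : ℝ) (hr : 0 < r) : eball n x r ⊆ bx n x r := by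
  intro y hy
  have hy : Real.sqrt (∑ i, (x i - y i) ^ 2) < r := hy
  refine Set.mem_univ_pi.2 fun i => ?_
  have h1 : |x i - y i| ≤ Real.sqrt (∑ i, (x i - y i) ^ 2) := by
    rw [← Real.sqrt_sq_eq_abs]
    exact Real.sqrt_le_sqrt (Finset.single_le_sum (f := fun i => (x i - y i) ^ 2)
      (fun i _ => sq_nonneg _) (Finset.mem_univ i))
  have h2 := abs_lt.1 (h1.trans_lt hy)
  exact ⟨by linarith [h2.2], by linarith [h2.1]⟩

lemma bx_sub_eball (n : ℕ) (hn : 0 < n) (x : Fin n → ℝ) (r : ℝ) (hr : 0 < r) :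
    bx n x (r / n) ⊆ eball n x r := by
  intro y hy
  have hn' : (1 : ℝ) ≤ n := by exact_mod_cast hn
  have hy := Set.mem_univ_pi.1 hy
  have hne : (Finset.univ : Finset (Fin n)).Nonempty := ⟨⟨0, hn⟩, Finset.mem_univ _⟩
  have hs : ∑ i, (x i - y i) ^ 2 < ∑ _i : Fin n, (r / n) ^ 2 := by
    refine Finset.sum_lt_sum_of_nonempty hne fun i _ => ?_
    refine sq_lt_sq' ?_ ?_
    · linarith [(hy i).2]
    · linarith [(hy i).1]
  have hs2 : ∑ _i : Fin n, (r / n) ^ 2 ≤ r ^ 2 := by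
    rw [Finset.sum_const, Finset.card_univ, Fintype.card_fin, nsmul_eq_mul]
    have : (n : ℝ) * (r / n) ^ 2 = r ^ 2 / n := by field_simp
    rw [this]
    exact div_le_self (sq_nonneg r) hn'
  change Real.sqrt (∑ i, (x i - y i) ^ 2) < r
  rw [Real.sqrt_lt' hr]
  exact hs.trans_le hs2

lemma ball_av (n : ℕ) (hn : 0 < n) (x : Fin n → ℝ) (r : ℝ) (hr : 0 < r)
    (g : (Fin n → ℝ) → ℝ≥0∞) (hg : Measurable g) :
    (volume (eball n x r))⁻¹ * ∫⁻ y in eball n x r, g y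
      ≤ ENNReal.ofReal (2 * n) ^ n * SM n g x := by
  have hn' : (0 : ℝ) < n := by exact_mod_cast hn
  have hv : ENNReal.ofReal (2 * r / n) ^ n ≤ volume (eball n x r) := by
    refine le_trans (le_of_eq ?_) (measure_mono (bx_sub_eball n hn x r hr))
    unfold bx
    rw [Real.volume_pi_Ioo]
    have : ∀ i, x i + r / n - (x i - r / n) = 2 * r / n := fun i => by ring
    simp [this]
  have hp : 0 < 2 * r / n := by positivity
  calc (volume (eball n x r))⁻¹ * ∫⁻ y in eball n x r, g y
      ≤ (ENNReal.ofReal (2 * r / n) ^ n)⁻¹ * (ENNReal.ofReal (4 * r) ^ n * SM n g x) := by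
        refine mul_le_mul' (ENNReal.inv_le_inv.2 hv) ?_
        exact (lintegral_mono_set (eball_sub_bx n x r hr)).trans (box_le n x r hr g hg)
    _ = _ := by
        rw [← mul_assoc]
        congr 1
        have : (4 * r) = (2 * r / n) * (2 * n) := by field_simp; ring
        rw [this, ENNReal.ofReal_mul hp.le, mul_pow, ← mul_assoc, ENNReal.inv_mul_cancel, one_mul]
        · exact pow_ne_zero _ (by simpa using hp)
        · exact ENNReal.pow_ne_top ENNReal.ofReal_ne_top

/-! ### The Hölder inequality for mixed norms -/

lemma mL_holder {m : ℕ} : ∀ (n : ℕ) (Q : Fin m → Fin n → ℝ) (q : Fin n → ℝ), (∀ i j, 0 < Q i j) →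
    (∀ j, 0 < q j) → (∀ j, 1 / q j = ∑ i, 1 / Q i j) →
    ∀ g : Fin m → (Fin n → ℝ) → ℝ≥0∞, (∀ i, Measurable (g i)) →
    mixedLnorm n q (fun x => ∏ i, g i x) ≤ ∏ i, mixedLnorm n (Q i) (g i)
  | 0, Q, q, hQ, hq0, hq, g, hg => by simp [mixedLnorm]
  | n + 1, Q, q, hQ, hq0, hq, g, hg => by
    simp only [mixedLnorm]
    have h0 := hq0 (Fin.last n)
    set qn := q (Fin.last n)
    have hgm : ∀ i, Measurable (fun z : ℝ × (Fin n → ℝ) => g i (Fin.snoc z.2 z.1)) := fun i =>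
      (hg i).comp ((snoc_meas n).comp measurable_swap)
    set G : Fin m → ℝ → ℝ≥0∞ := fun i t =>
      mixedLnorm n (fun j => Q i j.castSucc) (fun y => g i (Fin.snoc y t)) with hG
    have hGm : ∀ i, Measurable (G i) := fun i => mL_meas n _ _ (hgm i)
    have step : ∫⁻ t : ℝ, mixedLnorm n (fun i => q i.castSucc) (fun y => ∏ i, g i (Fin.snoc y t)) ^ qn
        ≤ ∏ i, (∫⁻ t, G i t ^ Q i (Fin.last n)) ^ (qn / Q i (Fin.last n)) := by
      calc _ ≤ ∫⁻ t, ∏ i, (G i t ^ Q i (Fin.last n)) ^ (qn / Q i (Fin.last n)) := by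
            refine lintegral_mono fun t => ?_
            have e : ∀ i, (G i t ^ Q i (Fin.last n)) ^ (qn / Q i (Fin.last n)) = G i t ^ qn := by
              intro i
              rw [← ENNReal.rpow_mul, mul_div_cancel₀ _ (hQ i (Fin.last n)).ne']
            simp_rw [e]
            rw [ENNReal.prod_rpow_of_nonneg h0.le]
            refine ENNReal.rpow_le_rpow ?_ h0.le
            exact mL_holder n (fun i j => Q i j.castSucc) (fun j => q j.castSucc) (fun i j => hQ _ _)
              (fun j => hq0 _) (fun j => hq _) _
              (fun i => (hgm i).comp (measurable_const.prodMk measurable_id))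
        _ ≤ _ := by
            refine ENNReal.lintegral_prod_norm_pow_le (p := fun i => qn / Q i (Fin.last n))
              Finset.univ (fun i _ => ((hGm i).pow_const _).aemeasurable) ?_ ?_
            · have := hq (Fin.last n)
              simp_rw [div_eq_mul_one_div qn]
              rw [← Finset.mul_sum, ← this, mul_one_div_cancel h0.ne']
            · intro i _
              have := hQ i (Fin.last n)
              positivity
    refine (ENNReal.rpow_le_rpow step (by positivity)).trans (le_of_eq ?_)
    rw [← ENNReal.prod_rpow_of_nonneg (by positivity)]
    refine Finset.prod_congr rfl fun i _ => ?_
    rw [← ENNReal.rpow_mul]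
    congr 1
    have := hQ i (Fin.last n)
    field_simp

theorem stmt11 (n m : ℕ) (hn : 0 < n) (hm : 2 ≤ m)
    (Q : Fin m → Fin n → ℝ) (hQ : ∀ i j, 1 < Q i j)
    (q : Fin n → ℝ) (hq : ∀ j, 1 / q j = ∑ i, 1 / Q i j) :
    ∃ C : ℝ, 0 < C ∧ ∀ f : Fin m → ((Fin n → ℝ) → ℝ),
      (∀ i, Measurable (f i)) → (∀ i, mixedNorm n (Q i) (f i) ≠ ⊤) →
      mixedLnorm n q (multiMax n m f)
        ≤ ENNReal.ofReal C * ∏ i, mixedNorm n (Q i) (f i) := by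
  have hQ0 : ∀ i j, 0 < Q i j := fun i j => by linarith [hQ i j]
  have hq0 : ∀ j, 0 < q j := by
    intro j
    have : 0 < 1 / q j := by
      rw [hq j]
      refine Finset.sum_pos (fun i _ => by have := hQ0 i j; positivity) ⟨⟨0, by omega⟩, Finset.mem_univ _⟩
    exact one_div_pos.1 this
  choose A hA hAb using fun i => SM_bdd n (Q i) (hQ i)
  set c : ℝ≥0∞ := ENNReal.ofReal (2 * n) ^ n with hc
  have hcT : c ≠ ⊤ := ENNReal.pow_ne_top ENNReal.ofReal_ne_top
  set D : ℝ≥0∞ := c ^ m * ∏ i, A i with hD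
  have hDT : D ≠ ⊤ :=
    ENNReal.mul_ne_top (ENNReal.pow_ne_top hcT) (ENNReal.prod_ne_top fun i _ => hA i)
  refine ⟨D.toReal + 1, by positivity, ?_⟩
  intro f hf _
  have hDle : D ≤ ENNReal.ofReal (D.toReal + 1) := by
    rw [← ENNReal.ofReal_toReal hDT]
    exact ENNReal.ofReal_le_ofReal (by rw [ENNReal.toReal_ofReal ENNReal.toReal_nonneg]; linarith)
  refine le_trans ?_ (mul_le_mul_left hDle _)
  have hfm : ∀ i, Measurable (fun x => ENNReal.ofReal |f i x|) := fun i => by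
    have := hf i
    fun_prop
  have hpt : ∀ x, multiMax n m f x ≤ c ^ m * ∏ i, SM n (fun x => ENNReal.ofReal |f i x|) x := by
    intro x
    refine iSup₂_le fun r hr => ?_
    calc _ ≤ ∏ i : Fin m, c * SM n (fun x => ENNReal.ofReal |f i x|) x :=
          Finset.prod_le_prod' fun i _ => ball_av n hn x r hr _ (hfm i)
      _ = _ := by
          rw [Finset.prod_mul_distrib, Finset.prod_const, Finset.card_univ, Fintype.card_fin]
  refine (mL_mono n q hq0 _ _ hpt).trans ?_
  rw [mL_const n q hq0 _ (ENNReal.pow_ne_top hcT), hD, mul_assoc, ← Finset.prod_mul_distrib]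
  refine mul_le_mul_right ?_ _
  refine (mL_holder n Q q hQ0 hq0 hq _ fun i => ?_).trans ?_
  · exact (SM_meas n (α := Unit) (fun z => ENNReal.ofReal |f i z.2|)
      ((hfm i).comp measurable_snd)).comp (measurable_const.prodMk measurable_id :
        Measurable (fun x : Fin n → ℝ => (((), x) : Unit × (Fin n → ℝ))))
  · exact Finset.prod_le_prod' fun i _ => hAb i _ (hfm i)
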